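/- There exist a constant c_p > 0 depending only on p, a constant ε₀ > 0 depending only on p, and a constant μ > 0 depending on p and ψ, such that if ψ̂(0) ≥ c_p·‖ψ‖₂, then for every ε ∈ (0, ε₀) there is a constant b > 0 such that for every integer n ∉ {0, 1, −1} and every t ∈ (T/2, T): |k̂(n,t)| ≤ b·e^{−μ|n|}·(T−t)^{ε}. -/

import Mathlib

open Real MeasureTheory Filter Set

/-- The `n`-th Fourier coefficient of a `2π`-periodic function `f : ℝ → ℝ`:
`f̂(n) = (1/2π) ∫₀^{2π} f(θ) e^{-inθ} dθ`. -/
noncomputable def fCoeff (f : ℝ → ℝ) (n : ℤ) : ℂ :=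
  (1 / (2 * Real.pi)) * ∫ θ in (0:ℝ)..(2 * Real.pi),
    (f θ : ℂ) * Complex.exp (-(Complex.I * n * θ))

/-- The seminorm `‖f‖₂ = max{sup_n n²|Re f̂(n)|, sup_n n²|Im f̂(n)|}`. -/
noncomputable def seminorm2 (f : ℝ → ℝ) : ℝ :=
  max (⨆ n : ℤ, (n : ℝ)^2 * |(fCoeff f n).re|)
      (⨆ n : ℤ, (n : ℝ)^2 * |(fCoeff f n).im|)

/-- The `C^l[0,2π]` norm: `max_{0 ≤ j ≤ l} sup_{θ ∈ [0,2π]} |f^{(j)}(θ)|`. -/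
noncomputable def ClNorm (l : ℕ) (f : ℝ → ℝ) : ℝ :=
  ⨆ j : Fin (l + 1), ⨆ θ : Set.Icc (0:ℝ) (2 * Real.pi),
    |iteratedDeriv (j : ℕ) f (θ : ℝ)|

/-- `k : ℝ × [0,T) → ℝ` is a smooth, `2π`-periodic (in space), strictly positive solution of the
`p`-curve shortening equation
`∂k/∂t = k²(k^{p-1} ∂²k/∂θ² + (p-1) k^{p-2} (∂k/∂θ)² + (1/p) k^p)`
with initial datum `ψ` (smooth, strictly positive, `2π`-periodic), blow-up time `T`
(i.e. `sup_θ k(θ,t) → ∞` as `t → T⁻`), such that `k(·,t)` is the curvature of a simple closed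
convex curve for each `t`, i.e. `∫₀^{2π} e^{iθ}/k(θ,t) dθ = 0`. -/
def IsPCSF (p : ℕ) (T : ℝ) (k : ℝ → ℝ → ℝ) (ψ : ℝ → ℝ) : Prop :=
  ContDiffOn ℝ (⊤ : ℕ∞) (fun q : ℝ × ℝ => k q.1 q.2) (Set.univ ×ˢ Set.Ico 0 T) ∧
  (∀ θ t, k (θ + 2 * Real.pi) t = k θ t) ∧
  (∀ θ : ℝ, ∀ t ∈ Set.Ico (0:ℝ) T, 0 < k θ t) ∧
  (∀ θ : ℝ, ∀ t ∈ Set.Ico (0:ℝ) T,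
    HasDerivAt (fun s => k θ s)
      ((k θ t)^2 * ((k θ t)^(p - 1) * deriv (deriv (fun x => k x t)) θ
        + ((p : ℝ) - 1) * (k θ t)^(p - 2) * (deriv (fun x => k x t) θ)^2
        + (1 / (p : ℝ)) * (k θ t)^p)) t) ∧
  (∀ θ, k θ 0 = ψ θ) ∧
  ContDiff ℝ (⊤ : ℕ∞) ψ ∧ (∀ θ, 0 < ψ θ) ∧ (∀ θ, ψ (θ + 2 * Real.pi) = ψ θ) ∧
  Filter.Tendsto (fun t => ⨆ θ : Set.Icc (0:ℝ) (2 * Real.pi), k (θ : ℝ) t)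
    (nhdsWithin T (Set.Iio T)) Filter.atTop ∧
  (∀ t ∈ Set.Ico (0:ℝ) T,
    (∫ θ in (0:ℝ)..(2 * Real.pi), Complex.exp (Complex.I * θ) / (k θ t)) = 0)

/-- The original time `t` corresponding to the rescaled time `τ`:
`t = T(1 - e^{-(p+1)τ})`, i.e. `τ = -(1/(p+1))·log(1 - t/T)`. -/
noncomputable def tOf (p : ℕ) (T τ : ℝ) : ℝ := T * (1 - Real.exp (-((p : ℝ) + 1) * τ))

/-- The normalized curvature `k̃(θ,τ) = ((p+1)/p)^{1/(p+1)} (T-t)^{1/(p+1)} k(θ,t)`,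
with `t = T(1 - e^{-(p+1)τ})`. -/
noncomputable def ktilde (p : ℕ) (T : ℝ) (k : ℝ → ℝ → ℝ) (θ τ : ℝ) : ℝ :=
  (((p : ℝ) + 1) / (p : ℝ)) ^ ((1 : ℝ) / ((p : ℝ) + 1))
    * (T - tOf p T τ) ^ ((1 : ℝ) / ((p : ℝ) + 1)) * k θ (tOf p T τ)

theorem norm_fourierMode (n : ℤ) (θ : ℝ) : ‖Complex.exp (-(Complex.I * n * θ))‖ = 1 := by
  rw [Complex.norm_exp]; simp

theorem norm_exp_I_mul_int_mul (n : ℤ) (θ : ℝ) : ‖Complex.exp (Complex.I * n * θ)‖ = 1 := by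
  rw [Complex.norm_exp]; simp

theorem intervalIntegrable_mul_fourierMode {f : ℝ → ℝ} (hf : Continuous f) (n : ℤ) :
    IntervalIntegrable (fun θ : ℝ => (f θ : ℂ) * Complex.exp (-(Complex.I * n * θ)))
      volume 0 (2 * π) :=
  Continuous.intervalIntegrable (by fun_prop) _ _

theorem fCoeff_add {f g : ℝ → ℝ} (hf : Continuous f) (hg : Continuous g) (n : ℤ) :
    fCoeff (fun θ => f θ + g θ) n = fCoeff f n + fCoeff g n := by
  unfold fCoeff
  rw [← mul_add, ← intervalIntegral.integral_add (intervalIntegrable_mul_fourierMode hf n)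
    (intervalIntegrable_mul_fourierMode hg n)]
  congr 2; ext θ; push_cast; ring

theorem fCoeff_const_mul (f : ℝ → ℝ) (c : ℝ) (n : ℤ) :
    fCoeff (fun θ => c * f θ) n = c * fCoeff f n := by
  unfold fCoeff
  rw [mul_left_comm, ← intervalIntegral.integral_const_mul (c : ℂ)]
  congr 2; ext θ; push_cast; ring

theorem fCoeff_sub {f g : ℝ → ℝ} (hf : Continuous f) (hg : Continuous g) (n : ℤ) :
    fCoeff (fun θ => f θ - g θ) n = fCoeff f n - fCoeff g n := by
  have h := fCoeff_add hf (hg.const_mul (-1)) n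
  rw [fCoeff_const_mul] at h
  simpa [sub_eq_add_neg] using h

theorem integral_fourierMode (n : ℤ) :
    ∫ θ in (0:ℝ)..(2 * π), Complex.exp (-(Complex.I * n * θ)) =
      if n = 0 then (2 * π : ℂ) else 0 := by
  split_ifs with h
  · subst h; simp
  · have hc : -(Complex.I * n) ≠ 0 := by simp [h]
    have h1 := integral_exp_mul_complex (a := 0) (b := 2 * π) hc
    have h2 : Complex.exp (-(Complex.I * n) * ((2 * π : ℝ) : ℂ)) = 1 := by
      rw [Complex.exp_eq_one_iff]
      exact ⟨-n, by push_cast; ring⟩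
    rw [h2] at h1
    simpa [neg_mul] using h1

theorem fCoeff_const (c : ℝ) (n : ℤ) :
    fCoeff (fun _ => c) n = if n = 0 then (c : ℂ) else 0 := by
  unfold fCoeff
  rw [intervalIntegral.integral_const_mul, integral_fourierMode]
  split_ifs
  · field_simp
  · simp

theorem norm_fCoeff_le {f : ℝ → ℝ} {A : ℝ} (hf : ∀ θ ∈ Icc 0 (2 * π), |f θ| ≤ A) (n : ℤ) :
    ‖fCoeff f n‖ ≤ A := by
  unfold fCoeff
  have hπ := Real.pi_pos
  have h := intervalIntegral.norm_integral_le_of_norm_le_const (a := 0) (b := 2 * π) (C := A)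
    (f := fun θ : ℝ => (f θ : ℂ) * Complex.exp (-(Complex.I * n * θ))) (by
      intro θ hθ
      rw [uIoc_of_le (by positivity)] at hθ
      rw [norm_mul, norm_fourierMode, mul_one, Complex.norm_real]
      exact hf θ (Ioc_subset_Icc_self hθ))
  rw [norm_mul]
  have h2 : ‖(1 / (2 * π) : ℂ)‖ = 1 / (2 * π) := by
    rw [show (1 / (2 * π) : ℂ) = ((1 / (2 * π) : ℝ) : ℂ) by push_cast; rfl, Complex.norm_real,
      Real.norm_of_nonneg (by positivity)]
  rw [h2, sub_zero, abs_of_pos (by positivity)] at *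
  calc _ ≤ 1 / (2 * π) * (A * (2 * π)) := by gcongr
    _ = A := by field_simp

theorem fCoeff_deriv {f f' : ℝ → ℝ} (hf : ∀ θ, HasDerivAt f (f' θ) θ) (hf' : Continuous f')
    (hper : f (2 * π) = f 0) (n : ℤ) : fCoeff f' n = Complex.I * n * fCoeff f n := by
  unfold fCoeff
  have h := intervalIntegral.integral_mul_deriv_eq_deriv_mul (a := 0) (b := 2 * π)
    (u := fun θ : ℝ => Complex.exp (-(Complex.I * n * θ)))
    (u' := fun θ : ℝ => Complex.exp (-(Complex.I * n * θ)) * (-(Complex.I * n)))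
    (v := fun θ => (f θ : ℂ)) (v' := fun θ => (f' θ : ℂ))
    (fun θ _ => by
      have h1 : HasDerivAt (fun θ : ℝ => -(Complex.I * n * (θ : ℂ))) (-(Complex.I * n)) θ := by
        simpa using! ((Complex.ofRealCLM.hasDerivAt (x := θ)).const_mul (Complex.I * n)).neg
      exact h1.cexp)
    (fun θ _ => (hf θ).ofReal_comp)
    (Continuous.intervalIntegrable (by fun_prop) _ _)
    (Continuous.intervalIntegrable (by fun_prop) _ _)
  have e2 : Complex.exp (-(Complex.I * n * ((2 * π : ℝ) : ℂ))) = 1 := by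
    rw [Complex.exp_eq_one_iff]
    exact ⟨-n, by push_cast; ring⟩
  simp only [e2, hper] at h
  have h3 : ∫ θ in (0:ℝ)..(2 * π), (f' θ : ℂ) * Complex.exp (-(Complex.I * n * θ)) =
      Complex.I * n * ∫ θ in (0:ℝ)..(2 * π), (f θ : ℂ) * Complex.exp (-(Complex.I * n * θ)) := by
    rw [← intervalIntegral.integral_const_mul]
    simp only [mul_comm ((f' _ : ℝ) : ℂ)]
    rw [h]
    simp [← intervalIntegral.integral_neg, mul_comm, mul_left_comm]
  rw [h3]; ring

theorem fCoeff_deriv_deriv {f f' f'' : ℝ → ℝ} (hf : ∀ θ, HasDerivAt f (f' θ) θ)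
    (hf' : ∀ θ, HasDerivAt f' (f'' θ) θ) (hf'' : Continuous f'')
    (hper : f (2 * π) = f 0) (hper' : f' (2 * π) = f' 0) (n : ℤ) :
    fCoeff f'' n = -(n : ℂ) ^ 2 * fCoeff f n := by
  rw [fCoeff_deriv hf' hf'' hper', fCoeff_deriv hf
    (continuous_iff_continuousAt.2 fun θ => (hf' θ).continuousAt) hper]
  linear_combination (n : ℂ) ^ 2 * fCoeff f n * Complex.I_sq

theorem hasSum_fCoeff {f : ℝ → ℝ} (hf : Continuous f) (hper : ∀ θ, f (θ + 2 * π) = f θ)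
    (hs : Summable fun n => ‖fCoeff f n‖) (θ : ℝ) :
    HasSum (fun n : ℤ => fCoeff f n * Complex.exp (Complex.I * n * θ)) (f θ : ℂ) := by
  have : Fact (0 < 2 * π) := ⟨by positivity⟩
  have hp : Function.Periodic (fun θ => (f θ : ℂ)) (2 * π) := fun θ => by simp [hper]
  let F : C(AddCircle (2 * π), ℂ) :=
    ⟨hp.lift, by
      refine continuous_coinduced_dom.mpr ?_
      exact (Complex.continuous_ofReal.comp hf)⟩
  have hF : ∀ x : ℝ, F (x : AddCircle (2 * π)) = f x := fun x => rfl
  have hc : ∀ n, fourierCoeff F n = fCoeff f n := by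
    intro n
    rw [fourierCoeff_eq_intervalIntegral _ _ 0, fCoeff, zero_add, Complex.real_smul]
    push_cast
    congr 2
    ext x
    rw [fourier_coe_apply, hF, smul_eq_mul, mul_comm]
    congr 2
    push_cast
    field_simp
  have h := has_pointwise_sum_fourier_series_of_summable (f := F)
    (by simpa [funext hc] using hs.of_norm) (θ : AddCircle (2 * π))
  rw [hF] at h
  convert h using 2 with n
  rw [hc, fourier_coe_apply, smul_eq_mul]
  congr 2
  push_cast
  field_simp

theorem fCoeff_eq_of_hasSum {f : ℝ → ℝ} {a : ℤ → ℂ} (ha : Summable fun n => ‖a n‖)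
    (h : ∀ θ : ℝ, HasSum (fun n : ℤ => a n * Complex.exp (Complex.I * n * θ)) (f θ : ℂ)) (n : ℤ) :
    fCoeff f n = a n := by
  have hs := intervalIntegral.hasSum_integral_of_dominated_convergence (μ := volume)
    (a := 0) (b := 2 * π)
    (F := fun (m : ℤ) (θ : ℝ) => a m * Complex.exp (-(Complex.I * ((n - m : ℤ) : ℂ) * θ)))
    (f := fun θ : ℝ => (f θ : ℂ) * Complex.exp (-(Complex.I * n * θ)))
    (fun m _ => ‖a m‖) (fun m => Continuous.aestronglyMeasurable (by fun_prop))
    (fun m => .of_forall fun θ _ => by rw [norm_mul, norm_fourierMode, mul_one])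
    (.of_forall fun θ _ => ha) (by simp)
    (.of_forall fun θ _ => by
      refine ((h θ).mul_right (Complex.exp (-(Complex.I * n * θ)))).congr_fun fun m => ?_
      rw [mul_assoc (a m), ← Complex.exp_add]
      congr 2; push_cast; ring)
  simp only [intervalIntegral.integral_const_mul, integral_fourierMode] at hs
  have h2 := hs.unique (hasSum_single n fun m hm => by
    rw [if_neg (by omega), mul_zero])
  rw [fCoeff, h2, sub_self, if_pos rfl]
  field_simp

/-- A submultiplicative weight on the frequencies, normalised to be `1` at frequency `0`. -/
structure IsFourierWeight (w : ℤ → ℝ) : Prop where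
  one_le : ∀ n, 1 ≤ w n
  zero : w 0 = 1
  add_le : ∀ m n, w (m + n) ≤ w m * w n

/-- `f` has an absolutely convergent Fourier expansion whose `w`-weighted `ℓ¹` norm is at
most `A`. -/
def WienerBound (w : ℤ → ℝ) (f : ℝ → ℝ) (A : ℝ) : Prop :=
  ∃ a : ℤ → ℂ,
    (∀ θ : ℝ, HasSum (fun n : ℤ => a n * Complex.exp (Complex.I * n * θ)) (f θ : ℂ)) ∧
    Summable (fun n => w n * ‖a n‖) ∧ ∑' n, w n * ‖a n‖ ≤ A

namespace IsFourierWeight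

variable {w : ℤ → ℝ}

theorem nonneg (hw : IsFourierWeight w) (n : ℤ) : 0 ≤ w n := zero_le_one.trans (hw.one_le n)

theorem norm_le (hw : IsFourierWeight w) (a : ℂ) (n : ℤ) : ‖a‖ ≤ w n * ‖a‖ :=
  le_mul_of_one_le_left (norm_nonneg _) (hw.one_le n)

theorem mul_norm_nonneg (hw : IsFourierWeight w) (a : ℤ → ℂ) (n : ℤ) : 0 ≤ w n * ‖a n‖ :=
  mul_nonneg (hw.nonneg n) (norm_nonneg _)

theorem summable_norm (hw : IsFourierWeight w) {a : ℤ → ℂ} (ha : Summable fun n => w n * ‖a n‖) :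
    Summable fun n => ‖a n‖ :=
  .of_nonneg_of_le (fun _ => norm_nonneg _) (fun n => hw.norm_le (a n) n) ha

end IsFourierWeight

namespace WienerBound

variable {w : ℤ → ℝ} {f g : ℝ → ℝ} {A B : ℝ}

theorem mono (h : WienerBound w f A) (hAB : A ≤ B) : WienerBound w f B := by
  obtain ⟨a, h1, h2, h3⟩ := h
  exact ⟨a, h1, h2, h3.trans hAB⟩

theorem congr (h : WienerBound w f A) (hfg : ∀ θ, g θ = f θ) : WienerBound w g A := by
  rwa [show g = f from funext hfg]

theorem summable_fCoeff (hw : IsFourierWeight w) (h : WienerBound w f A) :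
    Summable fun n => w n * ‖fCoeff f n‖ := by
  obtain ⟨a, h1, h2, -⟩ := h
  simpa only [fCoeff_eq_of_hasSum (hw.summable_norm h2) h1] using h2

theorem tsum_fCoeff_le (hw : IsFourierWeight w) (h : WienerBound w f A) :
    ∑' n, w n * ‖fCoeff f n‖ ≤ A := by
  obtain ⟨a, h1, h2, h3⟩ := h
  simpa only [fCoeff_eq_of_hasSum (hw.summable_norm h2) h1] using h3

theorem nonneg (hw : IsFourierWeight w) (h : WienerBound w f A) : 0 ≤ A :=
  (tsum_nonneg fun n => mul_nonneg (hw.nonneg n) (norm_nonneg _)).trans (h.tsum_fCoeff_le hw)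

theorem abs_le (hw : IsFourierWeight w) (h : WienerBound w f A) (θ : ℝ) : |f θ| ≤ A := by
  obtain ⟨a, h1, h2, h3⟩ := h
  have hn : Summable fun n => ‖a n‖ := hw.summable_norm h2
  have h4 : ‖(f θ : ℂ)‖ ≤ ∑' n, ‖a n‖ := by
    rw [← (h1 θ).tsum_eq]
    refine (norm_tsum_le_tsum_norm ?_).trans_eq ?_ <;>
      simp only [norm_mul, norm_exp_I_mul_int_mul, mul_one]
    exact hn
  rw [Complex.norm_real, Real.norm_eq_abs] at h4
  exact h4.trans ((hn.tsum_le_tsum (fun n => hw.norm_le (a n) n) h2).trans h3)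

theorem add (hw : IsFourierWeight w) (hf : WienerBound w f A) (hg : WienerBound w g B) :
    WienerBound w (fun θ => f θ + g θ) (A + B) := by
  obtain ⟨a, h1, h2, h3⟩ := hf
  obtain ⟨b, k1, k2, k3⟩ := hg
  have hle : ∀ n, w n * ‖a n + b n‖ ≤ w n * ‖a n‖ + w n * ‖b n‖ := fun n => by
    rw [← mul_add]
    exact mul_le_mul_of_nonneg_left (norm_add_le _ _) (hw.nonneg n)
  have hs : Summable fun n => w n * ‖a n + b n‖ :=
    .of_nonneg_of_le (fun n => mul_nonneg (hw.nonneg n) (norm_nonneg _)) hle (h2.add k2)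
  refine ⟨fun n => a n + b n, fun θ => ?_, hs, ?_⟩
  · simpa [add_mul] using (h1 θ).add (k1 θ)
  · exact (hs.tsum_le_tsum hle (h2.add k2)).trans ((h2.tsum_add k2).le.trans (add_le_add h3 k3))

theorem const_mul (hf : WienerBound w f A) (c : ℝ) :
    WienerBound w (fun θ => c * f θ) (|c| * A) := by
  obtain ⟨a, h1, h2, h3⟩ := hf
  have heq : ∀ n, w n * ‖(c : ℂ) * a n‖ = |c| * (w n * ‖a n‖) := fun n => by
    rw [norm_mul, Complex.norm_real, Real.norm_eq_abs]; ring
  refine ⟨fun n => c * a n, fun θ => ?_, ?_, ?_⟩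
  · simpa [mul_assoc] using (h1 θ).mul_left (c : ℂ)
  · simpa only [heq] using h2.mul_left |c|
  · simp only [heq, tsum_mul_left]
    exact mul_le_mul_of_nonneg_left h3 (abs_nonneg c)

theorem one (hw : IsFourierWeight w) : WienerBound w (fun _ => 1) 1 := by
  refine ⟨fun n => if n = 0 then 1 else 0, fun θ => ?_, ?_, ?_⟩
  · rw [Complex.ofReal_one]
    refine (hasSum_ite_eq (0 : ℤ) (1 : ℂ)).congr_fun fun n => ?_
    split_ifs with h <;> simp [h]
  · refine summable_of_ne_finset_zero (s := {0}) fun n hn => ?_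
    simp [show n ≠ 0 by simpa using hn]
  · rw [tsum_eq_single 0 fun n hn => by simp [hn]]
    simp [hw.zero]

theorem mul (hw : IsFourierWeight w) (hf : WienerBound w f A) (hg : WienerBound w g B) :
    WienerBound w (fun θ => f θ * g θ) (A * B) := by
  have hA := hf.nonneg hw
  obtain ⟨a, h1, h2, h3⟩ := hf
  obtain ⟨b, k1, k2, k3⟩ := hg
  have ha := hw.summable_norm h2
  have hb := hw.summable_norm k2
  let e : ℤ × ℤ ≃ ℤ × ℤ :=
    { toFun := fun x => (x.2, x.1 - x.2)
      invFun := fun x => (x.1 + x.2, x.1)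
      left_inv := fun x => by simp
      right_inv := fun x => by simp }
  have hP : Summable fun x : ℤ × ℤ => (w x.1 * ‖a x.1‖) * (w x.2 * ‖b x.2‖) :=
    h2.mul_of_nonneg k2 (hw.mul_norm_nonneg a) (hw.mul_norm_nonneg b)
  have hH : Summable fun x : ℤ × ℤ => (w x.2 * ‖a x.2‖) * (w (x.1 - x.2) * ‖b (x.1 - x.2)‖) :=
    e.summable_iff.2 hP
  have hHt : ∑' x : ℤ × ℤ, (w x.2 * ‖a x.2‖) * (w (x.1 - x.2) * ‖b (x.1 - x.2)‖) =
      (∑' n, w n * ‖a n‖) * ∑' n, w n * ‖b n‖ := by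
    rw [Summable.tsum_mul_tsum h2 k2 hP]
    exact e.tsum_eq fun x : ℤ × ℤ => (w x.1 * ‖a x.1‖) * (w x.2 * ‖b x.2‖)
  have hab : Summable fun x : ℤ × ℤ => ‖a x.2 * b (x.1 - x.2)‖ :=
    (e.summable_iff.2 (ha.mul_of_nonneg hb (fun n => norm_nonneg _)
      fun n => norm_nonneg _)).congr fun x => (norm_mul _ _).symm
  have hle : ∀ n, w n * ‖∑' m, a m * b (n - m)‖ ≤
      ∑' m, (w m * ‖a m‖) * (w (n - m) * ‖b (n - m)‖) := fun n => by
    have hn : Summable fun m => ‖a m * b (n - m)‖ := hab.prod_factor n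
    calc w n * ‖∑' m, a m * b (n - m)‖ ≤ w n * ∑' m, ‖a m * b (n - m)‖ :=
          mul_le_mul_of_nonneg_left (norm_tsum_le_tsum_norm hn) (hw.nonneg n)
      _ = ∑' m, w n * ‖a m * b (n - m)‖ := tsum_mul_left.symm
      _ ≤ _ := by
          refine (hn.mul_left _).tsum_le_tsum (fun m => ?_) (hH.prod_factor n)
          have h4 := hw.add_le m (n - m)
          rw [add_sub_cancel] at h4
          calc w n * ‖a m * b (n - m)‖ ≤ w m * w (n - m) * ‖a m * b (n - m)‖ :=
                mul_le_mul_of_nonneg_right h4 (norm_nonneg _)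
            _ = _ := by rw [norm_mul]; ring
  have hs : Summable fun n => w n * ‖∑' m, a m * b (n - m)‖ :=
    .of_nonneg_of_le (fun n => mul_nonneg (hw.nonneg n) (norm_nonneg _)) hle hH.prod
  refine ⟨fun n => ∑' m, a m * b (n - m), fun θ => ?_, hs, ?_⟩
  · have hF : Summable fun n : ℤ => ‖a n * Complex.exp (Complex.I * n * θ)‖ := by
      simpa only [norm_mul, norm_exp_I_mul_int_mul, mul_one] using ha
    have hG : Summable fun n : ℤ => ‖b n * Complex.exp (Complex.I * n * θ)‖ := by
      simpa only [norm_mul, norm_exp_I_mul_int_mul, mul_one] using hb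
    have hFG := summable_mul_of_summable_norm (R := ℂ)
      (f := fun n : ℤ => a n * Complex.exp (Complex.I * n * θ))
      (g := fun n : ℤ => b n * Complex.exp (Complex.I * n * θ)) hF hG
    have hp := (h1 θ).mul (k1 θ) hFG
    have hq : HasSum (fun x : ℤ × ℤ => a x.2 * b (x.1 - x.2) *
        Complex.exp (Complex.I * x.1 * θ)) (f θ * g θ) := by
      have hp' : HasSum ((fun x : ℤ × ℤ => (a x.1 * Complex.exp (Complex.I * x.1 * θ)) *
        (b x.2 * Complex.exp (Complex.I * x.2 * θ))) ∘ e) ((f θ : ℂ) * g θ) := e.hasSum_iff.2 hp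
      refine hp'.congr_fun fun x => ?_
      change _ = a x.2 * Complex.exp (Complex.I * x.2 * θ) *
        (b (x.1 - x.2) * Complex.exp (Complex.I * ((x.1 - x.2 : ℤ) : ℂ) * θ))
      rw [show Complex.I * x.1 * θ = Complex.I * x.2 * θ +
        Complex.I * ((x.1 - x.2 : ℤ) : ℂ) * θ by push_cast; ring, Complex.exp_add]
      ring
    rw [Complex.ofReal_mul]
    refine hq.prod_fiberwise fun n => ?_
    have hn : Summable fun m => a m * b (n - m) := (hab.prod_factor n).of_norm
    exact hn.hasSum.mul_right (Complex.exp (Complex.I * n * θ))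
  · calc _ ≤ ∑' n, ∑' m, (w m * ‖a m‖) * (w (n - m) * ‖b (n - m)‖) :=
          hs.tsum_le_tsum hle hH.prod
      _ = (∑' n, w n * ‖a n‖) * ∑' n, w n * ‖b n‖ := by rw [← hHt, hH.tsum_prod]
      _ ≤ A * B := mul_le_mul h3 k3 (tsum_nonneg (hw.mul_norm_nonneg b)) hA

theorem one_add_pow (hw : IsFourierWeight w) (hf : WienerBound w f A) (q : ℕ) :
    WienerBound w (fun θ => (1 + f θ) ^ q) ((1 + A) ^ q) := by
  induction q with
  | zero => simpa using one hw
  | succ q ih => simpa only [pow_succ] using ih.mul hw ((one hw).add hw hf)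

theorem one_add_pow_sub_one (hw : IsFourierWeight w) (hf : WienerBound w f A) (hA : A ≤ 1)
    (q : ℕ) : WienerBound w (fun θ => (1 + f θ) ^ q - 1) ((2 ^ q - 1) * A) := by
  have hA0 := hf.nonneg hw
  induction q with
  | zero => exact (((one hw).const_mul 0).congr fun θ => by simp).mono (by simp)
  | succ q ih =>
    refine (((ih.mul hw ((one hw).add hw hf)).add hw hf).congr fun θ => by ring).mono ?_
    have h1 : (1:ℝ) ≤ 2 ^ q := one_le_pow₀ one_le_two
    have h2 : 0 ≤ (2 ^ q - 1) * A * (1 - A) := by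
      have := sub_nonneg.2 h1; have := sub_nonneg.2 hA; positivity
    rw [pow_succ]
    nlinarith

theorem one_add_pow_sub_linear (hw : IsFourierWeight w) (hf : WienerBound w f A) (hA : A ≤ 1)
    (q : ℕ) :
    WienerBound w (fun θ => (1 + f θ) ^ q - 1 - q * f θ) ((2 ^ q - 1 - q) * A ^ 2) := by
  have hA0 := hf.nonneg hw
  induction q with
  | zero => exact (((one hw).const_mul 0).congr fun θ => by simp).mono (by simp)
  | succ q ih =>
    refine (((ih.mul hw ((one hw).add hw hf)).add hw ((hf.mul hw hf).const_mul q)).congr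
      fun θ => by push_cast; ring).mono ?_
    have h1 : (q:ℝ) + 1 ≤ 2 ^ q := by exact_mod_cast q.lt_two_pow_self
    have h2 : 0 ≤ (2 ^ q - 1 - q) * A ^ 2 * (1 - A) := by
      have : (0:ℝ) ≤ 2 ^ q - 1 - q := by linarith
      have := sub_nonneg.2 hA; positivity
    rw [pow_succ (2 : ℝ) q, abs_of_nonneg (Nat.cast_nonneg q)]
    push_cast
    nlinarith

end WienerBound

theorem WienerBound.of_summable {w : ℤ → ℝ} (hw : IsFourierWeight w) {f : ℝ → ℝ}
    (hf : Continuous f) (hper : ∀ θ, f (θ + 2 * π) = f θ)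
    (hs : Summable fun n => w n * ‖fCoeff f n‖) :
    WienerBound w f (∑' n, w n * ‖fCoeff f n‖) :=
  ⟨fCoeff f, hasSum_fCoeff hf hper (hw.summable_norm hs), hs, le_rfl⟩

/-- The nonlinear part of the `p`-curve shortening equation, linearised at the constant `1`. -/
theorem WienerBound.curvature_remainder {w : ℤ → ℝ} (hw : IsFourierWeight w) {p : ℕ}
    (hp : 1 ≤ p) {u u₁ u₂ : ℝ → ℝ} {x e d : ℝ} (hu : WienerBound w u x)
    (hu₁ : WienerBound w u₁ e) (hu₂ : WienerBound w u₂ d) (hx : x ≤ 1) (he : e ^ 2 ≤ x * d)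
    (hxd : x ≤ d) :
    WienerBound w (fun θ => ((1 + u θ) ^ (p + 1) - 1) * u₂ θ
      + ((p : ℝ) - 1) * ((1 + u θ) ^ p * (u₁ θ * u₁ θ))
      + 1 / (p : ℝ) * ((1 + u θ) ^ (p + 2) - 1 - (p + 2 : ℕ) * u θ))
      ((p + 6) * 2 ^ p * (x * d)) := by
  have hx0 := hu.nonneg hw
  have hp1 : (1 : ℝ) ≤ p := by exact_mod_cast hp
  refine ((((hu.one_add_pow_sub_one hw hx (p + 1)).mul hw hu₂).add hw
    (((hu.one_add_pow hw p).mul hw (hu₁.mul hw hu₁)).const_mul ((p : ℝ) - 1))).add hw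
    ((hu.one_add_pow_sub_linear hw hx (p + 2)).const_mul (1 / (p : ℝ)))).mono ?_
  rw [abs_of_nonneg (by linarith : (0:ℝ) ≤ p - 1), abs_of_nonneg (by positivity)]
  have h2 : (0:ℝ) < 2 ^ p := by positivity
  have hxd0 : 0 ≤ x * d := mul_nonneg hx0 (hx0.trans hxd)
  have e1 : ((2:ℝ) ^ (p + 1) - 1) * x * d ≤ 2 * 2 ^ p * (x * d) := by
    rw [pow_succ]; nlinarith
  have e2 : ((p : ℝ) - 1) * ((1 + x) ^ p * (e * e)) ≤ (p - 1) * (2 ^ p * (x * d)) := by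
    refine mul_le_mul_of_nonneg_left ?_ (by linarith)
    rw [← pow_two e]
    exact mul_le_mul (pow_le_pow_left₀ (by linarith) (by linarith) p) he (sq_nonneg e) h2.le
  have e3 : 1 / (p : ℝ) * ((2 ^ (p + 2) - 1 - (p + 2 : ℕ)) * x ^ 2) ≤ 4 * 2 ^ p * (x * d) := by
    have h4 : (2:ℝ) ^ (p + 2) - 1 - (p + 2 : ℕ) ≤ 4 * 2 ^ p := by
      rw [pow_add]; push_cast; linarith
    have h5 : ((2:ℝ) ^ (p + 2) - 1 - (p + 2 : ℕ)) * x ^ 2 ≤ 4 * 2 ^ p * (x * d) :=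
      mul_le_mul h4 (by rw [pow_two]; exact mul_le_mul_of_nonneg_left hxd hx0) (sq_nonneg x)
        (by positivity)
    have h6 : 1 / (p : ℝ) ≤ 1 := by rw [div_le_one (by linarith)]; exact hp1
    calc _ ≤ 1 / (p : ℝ) * (4 * 2 ^ p * (x * d)) := mul_le_mul_of_nonneg_left h5 (by positivity)
      _ ≤ 1 * (4 * 2 ^ p * (x * d)) := mul_le_mul_of_nonneg_right h6 (by positivity)
      _ = _ := one_mul _
  nlinarith [mul_nonneg h2.le hxd0]

theorem sq_tsum_abs_mul_le {b : ℤ → ℝ} (hb : ∀ n, 0 ≤ b n) (h0 : Summable b)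
    (h1 : Summable fun n : ℤ => |(n : ℝ)| * b n) (h2 : Summable fun n : ℤ => (n : ℝ) ^ 2 * b n) :
    (∑' n : ℤ, |(n : ℝ)| * b n) ^ 2 ≤ (∑' n, b n) * ∑' n : ℤ, (n : ℝ) ^ 2 * b n := by
  have key : ∀ s : ℝ, 0 ≤ (∑' n, b n) * (s * s) + (-2 * ∑' n : ℤ, |(n : ℝ)| * b n) * s
      + ∑' n : ℤ, (n : ℝ) ^ 2 * b n := fun s => by
    have h := ((h0.hasSum.mul_right (s * s)).add ((h1.hasSum.mul_left (-2)).mul_right s)).add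
      h2.hasSum
    refine h.nonneg fun n => ?_
    have : 0 ≤ (s - |(n : ℝ)|) ^ 2 * b n := mul_nonneg (sq_nonneg _) (hb n)
    calc (0:ℝ) ≤ _ := this
      _ = _ := by rw [← sq_abs (n : ℝ)]; ring
  have h := discrim_le_zero key
  rw [discrim] at h
  nlinarith

/-- Indicator of the frequencies other than `0, ±1`. -/
noncomputable def highMode (n : ℤ) : ℝ := if 2 ≤ |n| then 1 else 0

theorem highMode_nonneg (n : ℤ) : 0 ≤ highMode n := by
  unfold highMode; split_ifs <;> norm_num

theorem highMode_le_one (n : ℤ) : highMode n ≤ 1 := by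
  unfold highMode; split_ifs <;> norm_num

theorem highMode_zero : highMode 0 = 0 := by norm_num [highMode]

theorem highMode_of_two_le {n : ℤ} (hn : 2 ≤ |n|) : highMode n = 1 := by simp [highMode, hn]

theorem abs_norm_highMode_le (n : ℤ) (z : ℝ) : |highMode n * z| ≤ |z| := by
  rw [abs_mul, abs_of_nonneg (highMode_nonneg n)]
  exact mul_le_of_le_one_left (abs_nonneg z) (highMode_le_one n)

theorem highMode_mul_four_le (n : ℤ) : highMode n * 4 ≤ highMode n * (n : ℝ) ^ 2 := by
  unfold highMode
  split_ifs with h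
  · have h2 : (2:ℝ) ≤ |(n:ℝ)| := by exact_mod_cast h
    rw [← sq_abs]; nlinarith
  · simp

theorem Summable.highMode_mul {b : ℤ → ℝ} (h : Summable b) :
    Summable fun n => highMode n * b n :=
  .of_norm_bounded h.norm fun n => by simpa using! abs_norm_highMode_le n (b n)

theorem tsum_eq_highMode_add {b : ℤ → ℝ} (h : Summable b) :
    ∑' n, b n = ∑' n, highMode n * b n + (b (-1) + b 0 + b 1) := by
  have h2 : ∑' n, (1 - highMode n) * b n = b (-1) + b 0 + b 1 := by
    rw [tsum_eq_sum (s := {-1, 0, 1})]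
    · rw [Finset.sum_insert (by decide), Finset.sum_insert (by decide), Finset.sum_singleton]
      norm_num [highMode]
      ring
    · intro n hn
      simp only [Finset.mem_insert, Finset.mem_singleton, not_or] at hn
      rw [highMode_of_two_le (by rw [le_abs]; omega)]
      simp
  have h3 : Summable fun n => (1 - highMode n) * b n :=
    (h.sub h.highMode_mul).congr fun n => by ring
  rw [← h2, ← h.highMode_mul.tsum_add h3]
  exact tsum_congr fun n => by ring

theorem fCoeff_sub_const {f : ℝ → ℝ} (hf : Continuous f) (ℓ : ℝ) (n : ℤ) :
    fCoeff (fun θ => f θ - ℓ) n = fCoeff f n - if n = 0 then (ℓ : ℂ) else 0 := by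
  rw [fCoeff_sub hf continuous_const, fCoeff_const]

/-- If the reciprocal of `f` has the frequencies `0, ±1` of the constant `1 / ℓ`, then the
corresponding frequencies of `f - ℓ` are quadratically small. -/
theorem norm_fCoeff_low_le {f : ℝ → ℝ} (hf : Continuous f) {ℓ A : ℝ} (hℓ : 0 < ℓ)
    (hA : A ≤ ℓ / 2) (hfA : ∀ θ, |f θ - ℓ| ≤ A) {n : ℤ}
    (hn : fCoeff (fun θ => (f θ)⁻¹) n = if n = 0 then ((1 / ℓ : ℝ) : ℂ) else 0) :
    ‖fCoeff (fun θ => f θ - ℓ) n‖ ≤ 2 * A ^ 2 / ℓ := by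
  have hpos : ∀ θ, ℓ / 2 ≤ f θ := fun θ => by linarith [(abs_le.1 (hfA θ)).1]
  have hne : ∀ θ, f θ ≠ 0 := fun θ => by linarith [hpos θ]
  have hi : Continuous fun θ => (f θ)⁻¹ := hf.inv₀ hne
  have e1 : (fun θ => f θ - ℓ) =
      fun θ => (ℓ - ℓ ^ 2 * (f θ)⁻¹) + (f θ - ℓ) ^ 2 * (f θ)⁻¹ := by
    ext θ
    have := hne θ
    field_simp
    ring
  have e2 : fCoeff (fun θ => ℓ - ℓ ^ 2 * (f θ)⁻¹) n = 0 := by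
    rw [fCoeff_sub continuous_const (by fun_prop), fCoeff_const_mul, fCoeff_const, hn]
    split_ifs
    · have : (ℓ : ℂ) ≠ 0 := by exact_mod_cast hℓ.ne'
      push_cast; field_simp; ring
    · simp
  rw [e1, fCoeff_add (by fun_prop) (by fun_prop), e2, zero_add]
  refine norm_fCoeff_le (fun θ _ => ?_) n
  have h1 := hpos θ
  rw [abs_of_nonneg (mul_nonneg (sq_nonneg _) (inv_nonneg.2 (by linarith))), ← div_eq_mul_inv,
    div_le_div_iff₀ (by linarith) hℓ, ← sq_abs (f θ - ℓ)]
  have h2 : |f θ - ℓ| ^ 2 ≤ A ^ 2 := pow_le_pow_left₀ (abs_nonneg _) (hfA θ) 2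
  nlinarith [sq_nonneg A]

theorem highMode_mul_fCoeff_sub_const {f : ℝ → ℝ} (hf : Continuous f) (ℓ : ℝ) (w : ℤ → ℝ)
    (n : ℤ) : highMode n * (w n * ‖fCoeff (fun θ => f θ - ℓ) n‖) =
      highMode n * (w n * ‖fCoeff f n‖) := by
  rcases eq_or_ne n 0 with rfl | h
  · simp [highMode_zero]
  · rw [fCoeff_sub_const hf, if_neg h, sub_zero]

theorem summable_fCoeff_sub_const {f : ℝ → ℝ} (hf : Continuous f) (ℓ : ℝ) {w : ℤ → ℝ}
    (h : Summable fun n => w n * ‖fCoeff f n‖) :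
    Summable fun n => w n * ‖fCoeff (fun θ => f θ - ℓ) n‖ := by
  refine (h.congr_cofinite ?_)
  rw [EventuallyEq, eventually_cofinite]
  refine (finite_singleton (0 : ℤ)).subset fun n hn => ?_
  by_contra h0
  refine hn ?_
  rw [fCoeff_sub_const hf, if_neg (by simpa using h0), sub_zero]

/-- The total oscillation around `ℓ` is controlled by the frequencies other than `0, ±1`. -/
theorem tsum_le_two_mul_high {w : ℤ → ℝ} (hw : IsFourierWeight w) (hw1 : w 1 ≤ 2)
    (hw1' : w (-1) ≤ 2) {f : ℝ → ℝ} (hf : Continuous f) (hper : ∀ θ, f (θ + 2 * π) = f θ)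
    {ℓ : ℝ} (hℓ : 0 < ℓ) (hs : Summable fun n => w n * ‖fCoeff f n‖)
    (hX : ∑' n, w n * ‖fCoeff (fun θ => f θ - ℓ) n‖ ≤ ℓ / 20)
    (hinv : ∀ n : ℤ, |n| ≤ 1 →
      fCoeff (fun θ => (f θ)⁻¹) n = if n = 0 then ((1 / ℓ : ℝ) : ℂ) else 0) :
    ∑' n, w n * ‖fCoeff (fun θ => f θ - ℓ) n‖ ≤
      2 * ∑' n, highMode n * (w n * ‖fCoeff f n‖) := by
  have hs' := summable_fCoeff_sub_const hf ℓ hs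
  have hW := WienerBound.of_summable hw (f := fun θ => f θ - ℓ) (by fun_prop)
    (fun θ => by rw [hper]) hs'
  have hsplit := tsum_eq_highMode_add hs'
  simp only [highMode_mul_fCoeff_sub_const hf ℓ w] at hsplit
  set X := ∑' n, w n * ‖fCoeff (fun θ => f θ - ℓ) n‖
  have hX0 : 0 ≤ X := hW.nonneg hw
  have hlow : ∀ n : ℤ, |n| ≤ 1 → ‖fCoeff (fun θ => f θ - ℓ) n‖ ≤ X / 10 := fun n hn => by
    refine (norm_fCoeff_low_le hf hℓ (by linarith) (hW.abs_le hw) (hinv n hn)).trans ?_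
    rw [div_le_iff₀ hℓ]
    nlinarith
  have h1 := hlow 1 (by norm_num)
  have h2 := hlow (-1) (by norm_num)
  have h3 := hlow 0 (by norm_num)
  have k1 := mul_le_mul hw1 h1 (norm_nonneg _) (by norm_num)
  have k2 := mul_le_mul hw1' h2 (norm_nonneg _) (by norm_num)
  rw [hw.zero] at hsplit
  linarith

/-- The right-hand side of the `p`-curve shortening equation. -/
noncomputable def curvatureRate (p : ℕ) (f f₁ f₂ : ℝ) : ℝ :=
  f ^ 2 * (f ^ (p - 1) * f₂ + ((p : ℝ) - 1) * f ^ (p - 2) * f₁ ^ 2 + 1 / (p : ℝ) * f ^ p)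

theorem curvatureRate_eq {p : ℕ} (hp : 1 ≤ p) {ℓ : ℝ} (hℓ : ℓ ≠ 0) (f f₁ f₂ : ℝ) :
    curvatureRate p f f₁ f₂ = ℓ ^ (p + 1) * f₂ + ((p + 2 : ℝ) / p * ℓ ^ (p + 1)) * (f - ℓ)
      + 1 / p * ℓ ^ (p + 2)
      + ℓ ^ (p + 2) * (((1 + ℓ⁻¹ * (f - ℓ)) ^ (p + 1) - 1) * (ℓ⁻¹ * f₂)
        + ((p : ℝ) - 1) * ((1 + ℓ⁻¹ * (f - ℓ)) ^ p * ((ℓ⁻¹ * f₁) * (ℓ⁻¹ * f₁)))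
        + 1 / (p : ℝ) * ((1 + ℓ⁻¹ * (f - ℓ)) ^ (p + 2) - 1
          - (p + 2 : ℕ) * (ℓ⁻¹ * (f - ℓ)))) := by
  have e : 1 + ℓ⁻¹ * (f - ℓ) = ℓ⁻¹ * f := by field_simp; ring
  have hp0 : (p : ℝ) ≠ 0 := by positivity
  have h1 : f ^ 2 * f ^ (p - 1) = f ^ (p + 1) := by rw [← pow_add]; congr 1; omega
  have h2 : ((p : ℝ) - 1) * (f ^ 2 * f ^ (p - 2)) = (p - 1) * f ^ p := by
    rcases hp.eq_or_lt with rfl | h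
    · simp
    · rw [← pow_add]; congr 2; omega
  have h3 : f ^ 2 * f ^ p = f ^ (p + 2) := by rw [← pow_add]; congr 1; omega
  have lhs : curvatureRate p f f₁ f₂ =
      f ^ (p + 1) * f₂ + (p - 1) * f ^ p * f₁ ^ 2 + 1 / p * f ^ (p + 2) := by
    rw [curvatureRate, ← h1, ← h2, ← h3]; ring
  rw [lhs, e]
  simp only [mul_pow, inv_pow]
  push_cast
  field_simp
  ring

theorem rate_coefficient_expansion {w : ℤ → ℝ} (hw : IsFourierWeight w) {p : ℕ} (hp : 1 ≤ p)
    {f f₁ f₂ : ℝ → ℝ} (hf : ∀ θ, HasDerivAt f (f₁ θ) θ) (hf₁ : ∀ θ, HasDerivAt f₁ (f₂ θ) θ)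
    (hf₂ : Continuous f₂) (hper : ∀ θ, f (θ + 2 * π) = f θ)
    (hper₁ : ∀ θ, f₁ (θ + 2 * π) = f₁ θ) (hper₂ : ∀ θ, f₂ (θ + 2 * π) = f₂ θ)
    {ℓ : ℝ} (hℓ : 0 < ℓ) (hs : Summable fun n => w n * ‖fCoeff f n‖)
    (hs₂ : Summable fun n => w n * ‖fCoeff f₂ n‖)
    (hX : ∑' n, w n * ‖fCoeff (fun θ => f θ - ℓ) n‖ ≤ ℓ)
    (hXY : ∑' n, w n * ‖fCoeff (fun θ => f θ - ℓ) n‖ ≤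
      2 * ∑' n, highMode n * (w n * ‖fCoeff f n‖)) :
    ∃ r : ℤ → ℂ, (∀ n ≠ 0, fCoeff (fun θ => curvatureRate p (f θ) (f₁ θ) (f₂ θ)) n =
        ((ℓ ^ (p + 1) * ((p + 2 : ℝ) / p - n ^ 2) : ℝ) : ℂ) * fCoeff f n + r n) ∧
      Summable (fun n => w n * ‖r n‖) ∧
      ∑' n, w n * ‖r n‖ ≤ 2 * ((p + 6) * 2 ^ p) * ℓ ^ p *
        (∑' n, w n * ‖fCoeff (fun θ => f θ - ℓ) n‖) *
        ∑' n : ℤ, highMode n * ((n : ℝ) ^ 2 * (w n * ‖fCoeff f n‖)) := by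
  have cf : Continuous f := continuous_iff_continuousAt.2 fun θ => (hf θ).continuousAt
  have cf₁ : Continuous f₁ := continuous_iff_continuousAt.2 fun θ => (hf₁ θ).continuousAt
  have p2 : f (2 * π) = f 0 := by simpa using hper 0
  have p2' : f₁ (2 * π) = f₁ 0 := by simpa using hper₁ 0
  have hs' := summable_fCoeff_sub_const cf ℓ hs
  have hγ0 : ∀ n : ℤ, n ≠ 0 → fCoeff (fun θ => f θ - ℓ) n = fCoeff f n := fun n hn => by
    rw [fCoeff_sub_const cf, if_neg hn, sub_zero]
  have q2 : ∀ n : ℤ, w n * ‖fCoeff f₂ n‖ =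
      (n : ℝ) ^ 2 * (w n * ‖fCoeff (fun θ => f θ - ℓ) n‖) := fun n => by
    rw [fCoeff_deriv_deriv hf hf₁ hf₂ p2 p2', norm_mul, norm_neg, norm_pow, Complex.norm_intCast,
      sq_abs]
    rcases eq_or_ne n 0 with rfl | h
    · simp
    · rw [hγ0 n h]; ring
  have q1 : ∀ n : ℤ, w n * ‖fCoeff f₁ n‖ =
      |(n : ℝ)| * (w n * ‖fCoeff (fun θ => f θ - ℓ) n‖) := fun n => by
    rw [fCoeff_deriv hf cf₁ p2, norm_mul, norm_mul, Complex.norm_I, Complex.norm_intCast]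
    rcases eq_or_ne n 0 with rfl | h
    · simp
    · rw [hγ0 n h]; ring
  have hb : ∀ n, 0 ≤ w n * ‖fCoeff (fun θ => f θ - ℓ) n‖ := hw.mul_norm_nonneg _
  have hsq : Summable fun n : ℤ => (n : ℝ) ^ 2 * (w n * ‖fCoeff (fun θ => f θ - ℓ) n‖) :=
    hs₂.congr q2
  have hle1 : ∀ n : ℤ, |(n : ℝ)| ≤ (n : ℝ) ^ 2 := fun n => by

    rw [← Int.cast_abs, ← sq_abs, ← Int.cast_abs]
    exact_mod_cast Int.le_self_sq |n|
  have hab : Summable fun n : ℤ => |(n : ℝ)| * (w n * ‖fCoeff (fun θ => f θ - ℓ) n‖) :=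
    .of_nonneg_of_le (fun n => mul_nonneg (abs_nonneg _) (hb n))
      (fun n => mul_le_mul_of_nonneg_right (hle1 n) (hb n)) hsq
  have hs₁ : Summable fun n => w n * ‖fCoeff f₁ n‖ := hab.congr fun n => (q1 n).symm
  have W0 := WienerBound.of_summable hw (f := fun θ => f θ - ℓ) (by fun_prop)
    (fun θ => by rw [hper]) hs'
  have W1 := WienerBound.of_summable hw cf₁ hper₁ hs₁
  have W2 := WienerBound.of_summable hw hf₂ hper₂ hs₂
  have he := sq_tsum_abs_mul_le hb hs' hab hsq
  have hX0 := W0.nonneg hw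
  have sX := tsum_eq_highMode_add hs'
  have sD := tsum_eq_highMode_add hsq
  have hYD : 4 * ∑' n, highMode n * (w n * ‖fCoeff (fun θ => f θ - ℓ) n‖) ≤
      ∑' n : ℤ, highMode n * ((n : ℝ) ^ 2 * (w n * ‖fCoeff (fun θ => f θ - ℓ) n‖)) := by
    rw [← tsum_mul_left]
    refine (hs'.highMode_mul.mul_left 4).tsum_le_tsum (fun n => ?_) hsq.highMode_mul
    have := mul_le_mul_of_nonneg_right (highMode_mul_four_le n) (hb n)
    linarith
  have hDY : ∑' n : ℤ, highMode n * ((n : ℝ) ^ 2 * (w n * ‖fCoeff (fun θ => f θ - ℓ) n‖)) =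
      ∑' n : ℤ, highMode n * ((n : ℝ) ^ 2 * (w n * ‖fCoeff f n‖)) := tsum_congr fun n => by
    rw [mul_left_comm, highMode_mul_fCoeff_sub_const cf, mul_left_comm]
  have hY0 : 0 ≤ ∑' n, highMode n * (w n * ‖fCoeff (fun θ => f θ - ℓ) n‖) :=
    tsum_nonneg fun n => mul_nonneg (highMode_nonneg n) (hb n)
  simp only [highMode_mul_fCoeff_sub_const cf ℓ w] at sX hYD hY0
  simp only [q2] at W2
  simp only [q1] at W1
  rw [hDY] at hYD sD
  have hb1 := hb 1
  have hb2 := hb (-1)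
  have hb3 := hb 0
  set X := ∑' n, w n * ‖fCoeff (fun θ => f θ - ℓ) n‖ with hXdef
  set E := ∑' n : ℤ, |(n : ℝ)| * (w n * ‖fCoeff (fun θ => f θ - ℓ) n‖)
  set D := ∑' n : ℤ, (n : ℝ) ^ 2 * (w n * ‖fCoeff (fun θ => f θ - ℓ) n‖)
  set Y := ∑' n, highMode n * (w n * ‖fCoeff f n‖)
  set DY := ∑' n : ℤ, highMode n * ((n : ℝ) ^ 2 * (w n * ‖fCoeff f n‖))
  have hD : D ≤ 2 * DY := by norm_num at sD; linarith
  have hXD : X ≤ D := by norm_num at sD; linarith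
  have hi : 0 < ℓ⁻¹ := inv_pos.2 hℓ
  have V := WienerBound.curvature_remainder hw hp (W0.const_mul ℓ⁻¹) (W1.const_mul ℓ⁻¹)
    (W2.const_mul ℓ⁻¹) (by rw [abs_of_pos hi, inv_mul_le_iff₀ hℓ]; linarith)
    (by rw [abs_of_pos hi]; nlinarith [mul_le_mul_of_nonneg_left he (sq_nonneg ℓ⁻¹)])
    (by rw [abs_of_pos hi]; exact mul_le_mul_of_nonneg_left hXD hi.le)
  have V' := V.const_mul (ℓ ^ (p + 2))
  refine ⟨_, fun n hn => ?_, V'.summable_fCoeff hw, (V'.tsum_fCoeff_le hw).trans ?_⟩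
  · simp only [curvatureRate_eq hp hℓ.ne']
    rw [fCoeff_add (by fun_prop) (by fun_prop), fCoeff_add (by fun_prop) (by fun_prop),
      fCoeff_add (by fun_prop) (by fun_prop), fCoeff_const_mul _ (ℓ ^ (p + 1)), fCoeff_const,
      if_neg hn, fCoeff_const_mul _ ((p + 2 : ℝ) / p * ℓ ^ (p + 1)), hγ0 n hn,
      fCoeff_deriv_deriv hf hf₁ hf₂ p2 p2']
    push_cast
    ring
  · rw [abs_of_pos hi, abs_of_pos (by positivity)]
    have e1 : ℓ ^ (p + 2) * ((p + 6) * 2 ^ p * (ℓ⁻¹ * X * (ℓ⁻¹ * D))) =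
        ((p + 6) * 2 ^ p * ℓ ^ p * X) * D := by
      rw [pow_add]; field_simp
    rw [e1]
    calc _ ≤ ((p + 6) * 2 ^ p * ℓ ^ p * X) * (2 * DY) :=
          mul_le_mul_of_nonneg_left hD (by positivity)
      _ = _ := by ring

/-- Dissipation estimate: the formal time derivative of the weighted `ℓ¹` norm of the frequencies
other than `0, ±1` is negative, with a definite rate, as long as the oscillation is small. -/
theorem high_mode_dissipation {w : ℤ → ℝ} (hw : IsFourierWeight w) {p : ℕ} (hp : 1 ≤ p)
    {f f₁ f₂ : ℝ → ℝ} (hf : ∀ θ, HasDerivAt f (f₁ θ) θ) (hf₁ : ∀ θ, HasDerivAt f₁ (f₂ θ) θ)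
    (hf₂ : Continuous f₂) (hper : ∀ θ, f (θ + 2 * π) = f θ)
    (hper₁ : ∀ θ, f₁ (θ + 2 * π) = f₁ θ) (hper₂ : ∀ θ, f₂ (θ + 2 * π) = f₂ θ)
    {ℓ : ℝ} (hℓ : 0 < ℓ) (hs : Summable fun n => w n * ‖fCoeff f n‖)
    (hs₂ : Summable fun n => w n * ‖fCoeff f₂ n‖)
    (hX : 32 * ((p + 6) * 2 ^ p) * ∑' n, w n * ‖fCoeff (fun θ => f θ - ℓ) n‖ ≤ ℓ)
    (hXY : ∑' n, w n * ‖fCoeff (fun θ => f θ - ℓ) n‖ ≤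
      2 * ∑' n, highMode n * (w n * ‖fCoeff f n‖))
    {α : ℝ} (hα : 0 ≤ α) (hαℓ : α ≤ ℓ ^ (p + 1) / 16) {μ : ℤ → ℝ} (hμ : ∀ n, μ n ≤ |(n : ℝ)|)
    {σ : ℤ → ℂ} (hσ : ∀ n, ‖σ n‖ ≤ 1) (hσc : ∀ n, σ n * fCoeff f n = ‖fCoeff f n‖)
    (hsum : Summable fun n => highMode n * (α * μ n * (w n * ‖fCoeff f n‖) + w n *
      (σ n * fCoeff (fun θ => curvatureRate p (f θ) (f₁ θ) (f₂ θ)) n).re)) :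
    ∑' n, highMode n * (α * μ n * (w n * ‖fCoeff f n‖) + w n *
      (σ n * fCoeff (fun θ => curvatureRate p (f θ) (f₁ θ) (f₂ θ)) n).re) ≤
      -(1 / 2) * ℓ ^ (p + 1) * ∑' n, highMode n * (w n * ‖fCoeff f n‖) := by
  have cf : Continuous f := continuous_iff_continuousAt.2 fun θ => (hf θ).continuousAt
  have hp1 : (1 : ℝ) ≤ p := by exact_mod_cast hp
  have hX0 : 0 ≤ ∑' n, w n * ‖fCoeff (fun θ => f θ - ℓ) n‖ := tsum_nonneg (hw.mul_norm_nonneg _)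
  have hC : (1:ℝ) ≤ (p + 6) * 2 ^ p := by
    have : (1:ℝ) ≤ 2 ^ p := one_le_pow₀ one_le_two
    nlinarith
  obtain ⟨r, hr, hrs, hrle⟩ := rate_coefficient_expansion hw hp hf hf₁ hf₂ hper hper₁ hper₂ hℓ hs
    hs₂ (by nlinarith) hXY
  have hsD : Summable fun n : ℤ => highMode n * ((n : ℝ) ^ 2 * (w n * ‖fCoeff f n‖)) := by
    refine (hs₂.congr fun n => ?_).highMode_mul
    rw [fCoeff_deriv_deriv hf hf₁ hf₂ (by simpa using hper 0) (by simpa using hper₁ 0), norm_mul,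
      norm_neg, norm_pow, Complex.norm_intCast, sq_abs]
    ring
  have hsY := hs.highMode_mul
  have hYD : 4 * ∑' n, highMode n * (w n * ‖fCoeff f n‖) ≤
      ∑' n : ℤ, highMode n * ((n : ℝ) ^ 2 * (w n * ‖fCoeff f n‖)) := by
    rw [← tsum_mul_left]
    refine (hsY.mul_left 4).tsum_le_tsum (fun n => ?_) hsD
    have := mul_le_mul_of_nonneg_right (highMode_mul_four_le n) (hw.mul_norm_nonneg (fCoeff f) n)
    linarith
  have hterm : ∀ n : ℤ, highMode n * (α * μ n * (w n * ‖fCoeff f n‖) + w n *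
      (σ n * fCoeff (fun θ => curvatureRate p (f θ) (f₁ θ) (f₂ θ)) n).re) ≤
      3 * ℓ ^ (p + 1) * (highMode n * (w n * ‖fCoeff f n‖)) +
      -(15 / 16) * ℓ ^ (p + 1) * (highMode n * ((n : ℝ) ^ 2 * (w n * ‖fCoeff f n‖))) +
      w n * ‖r n‖ := fun n => by
    rcases eq_or_ne n 0 with rfl | hn
    · simpa [highMode_zero] using hw.mul_norm_nonneg r 0
    have e1 : (σ n * fCoeff (fun θ => curvatureRate p (f θ) (f₁ θ) (f₂ θ)) n).re =
        ℓ ^ (p + 1) * ((p + 2 : ℝ) / p - n ^ 2) * ‖fCoeff f n‖ + (σ n * r n).re := by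
      rw [hr n hn, mul_add, mul_left_comm, hσc, Complex.add_re, ← Complex.ofReal_mul,
        Complex.ofReal_re]
    have e2 : (σ n * r n).re ≤ ‖r n‖ := by
      refine (Complex.re_le_norm _).trans ?_
      rw [norm_mul]
      exact mul_le_of_le_one_left (norm_nonneg _) (hσ n)
    have e3 : α * μ n ≤ ℓ ^ (p + 1) / 16 * (n : ℝ) ^ 2 := by
      have h1 : |(n : ℝ)| ≤ (n : ℝ) ^ 2 := by
        rw [← Int.cast_abs, ← sq_abs, ← Int.cast_abs]
        exact_mod_cast Int.le_self_sq |n|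
      exact (mul_le_mul_of_nonneg_left ((hμ n).trans h1) hα).trans
        (mul_le_mul_of_nonneg_right hαℓ (sq_nonneg _))
    have e4 : (p + 2 : ℝ) / p ≤ 3 := by rw [div_le_iff₀ (by linarith)]; linarith
    have hwc := hw.mul_norm_nonneg (fCoeff f) n
    have hwr := hw.mul_norm_nonneg r n
    have hin : α * μ n * (w n * ‖fCoeff f n‖) + w n *
        (σ n * fCoeff (fun θ => curvatureRate p (f θ) (f₁ θ) (f₂ θ)) n).re ≤
        (3 * ℓ ^ (p + 1) - 15 / 16 * ℓ ^ (p + 1) * (n : ℝ) ^ 2) * (w n * ‖fCoeff f n‖) +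
          w n * ‖r n‖ := by
      rw [e1]
      have i1 := mul_le_mul_of_nonneg_right e3 hwc
      have i2 := mul_le_mul_of_nonneg_left e2 (hw.nonneg n)
      have i3 := mul_le_mul_of_nonneg_right
        (mul_le_mul_of_nonneg_left e4 (pow_pos hℓ (p + 1)).le) hwc
      nlinarith
    have h5 := mul_le_mul_of_nonneg_left hin (highMode_nonneg n)
    have h6 : highMode n * (w n * ‖r n‖) ≤ w n * ‖r n‖ :=
      mul_le_of_le_one_left hwr (highMode_le_one n)
    nlinarith
  refine (hsum.tsum_le_tsum hterm (((hsY.mul_left _).add (hsD.mul_left _)).add hrs)).trans ?_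
  rw [((hsY.mul_left _).add (hsD.mul_left _)).tsum_add hrs,
    (hsY.mul_left _).tsum_add (hsD.mul_left _), tsum_mul_left, tsum_mul_left]
  have hD0 : 0 ≤ ∑' n : ℤ, highMode n * ((n : ℝ) ^ 2 * (w n * ‖fCoeff f n‖)) :=
    tsum_nonneg fun n => mul_nonneg (highMode_nonneg n)
      (mul_nonneg (sq_nonneg _) (hw.mul_norm_nonneg _ n))
  set X := ∑' n, w n * ‖fCoeff (fun θ => f θ - ℓ) n‖
  set Y := ∑' n, highMode n * (w n * ‖fCoeff f n‖)
  set D := ∑' n : ℤ, highMode n * ((n : ℝ) ^ 2 * (w n * ‖fCoeff f n‖))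
  have hR : 2 * ((p + 6) * 2 ^ p) * ℓ ^ p * X * D ≤ 1 / 16 * ℓ ^ (p + 1) * D := by
    refine mul_le_mul_of_nonneg_right ?_ hD0
    have := mul_le_mul_of_nonneg_left hX (pow_pos hℓ p).le
    rw [pow_succ]
    linarith
  have := mul_le_mul_of_nonneg_left hYD (pow_pos hℓ (p + 1)).le
  linarith

/-- A family `t ↦ F (·, t)`, `t ∈ [0, T)`, of `2π`-periodic functions, jointly smooth. -/
structure IsSmoothFamily (T : ℝ) (F : ℝ × ℝ → ℝ) : Prop where
  smooth : ContDiffOn ℝ (⊤ : ℕ∞) F (univ ×ˢ Ico 0 T)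
  periodic : ∀ θ, ∀ t ∈ Ico 0 T, F (θ + 2 * π, t) = F (θ, t)

/-- The derivative in the space variable of a family on `ℝ × [0, T)`. -/
noncomputable def spaceDeriv (T : ℝ) (F : ℝ × ℝ → ℝ) (q : ℝ × ℝ) : ℝ :=
  fderivWithin ℝ F (univ ×ˢ Ico 0 T) q (1, 0)

theorem uniqueDiffOn_strip (T : ℝ) : UniqueDiffOn ℝ ((univ : Set ℝ) ×ˢ Ico 0 T) :=
  uniqueDiffOn_univ.prod (uniqueDiffOn_Ico 0 T)

theorem continuousOn_intervalIntegral_strip {E : Type*} [NormedAddCommGroup E] [NormedSpace ℝ E]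
    {T : ℝ} {G : ℝ × ℝ → E} (hG : ContinuousOn G (univ ×ˢ Ico 0 T)) (a b : ℝ) :
    ContinuousOn (fun t => ∫ θ in a..b, G (θ, t)) (Ico 0 T) := by
  rw [continuousOn_iff_continuous_domRestrict]
  refine intervalIntegral.continuous_parametric_intervalIntegral_of_continuous'
    (f := fun (t : Ico 0 T) θ => G (θ, (t : ℝ))) ?_ a b
  exact hG.comp_continuous (by fun_prop) fun q => ⟨mem_univ _, q.1.2⟩

theorem exists_bound_strip {E : Type*} [NormedAddCommGroup E] {T t₁ : ℝ} (ht₁ : t₁ < T)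
    {G : ℝ × ℝ → E} (hG : ContinuousOn G (univ ×ˢ Ico 0 T)) (a b : ℝ) :
    ∃ C, ∀ t ∈ Icc 0 t₁, ∀ θ ∈ Icc a b, ‖G (θ, t)‖ ≤ C := by
  have hsub : Icc a b ×ˢ Icc 0 t₁ ⊆ univ ×ˢ Ico 0 T :=
    prod_mono (subset_univ _) (Icc_subset_Ico_right ht₁)
  obtain ⟨C, hC⟩ :=
    (isCompact_Icc.prod isCompact_Icc).exists_bound_of_continuousOn (hG.mono hsub)
  exact ⟨C, fun t ht θ hθ => hC (θ, t) ⟨hθ, ht⟩⟩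

theorem hasDerivAt_intervalIntegral_strip {E : Type*} [NormedAddCommGroup E] [NormedSpace ℝ E]
    {T : ℝ} {G G' : ℝ × ℝ → E} (hG : ContinuousOn G (univ ×ˢ Ico 0 T))
    (hG' : ContinuousOn G' (univ ×ˢ Ico 0 T))
    (hd : ∀ θ, ∀ t ∈ Ioo 0 T, HasDerivAt (fun s => G (θ, s)) (G' (θ, t)) t) {a b : ℝ} (hab : a ≤ b)
    {t : ℝ} (ht : t ∈ Ioo 0 T) :
    HasDerivAt (fun s => ∫ θ in a..b, G (θ, s)) (∫ θ in a..b, G' (θ, t)) t := by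
  obtain ⟨t₁, ht₁, ht₁T⟩ := exists_between ht.2
  obtain ⟨C, hC⟩ := exists_bound_strip ht₁T hG' a b
  have hcont : ∀ {H : ℝ × ℝ → E}, ContinuousOn H (univ ×ˢ Ico 0 T) → ∀ s ∈ Ioo 0 T,
      Continuous fun θ => H (θ, s) := fun hH s hs =>
    hH.comp_continuous (by fun_prop) fun θ => ⟨mem_univ _, Ioo_subset_Ico_self hs⟩
  refine (intervalIntegral.hasDerivAt_integral_of_dominated_loc_of_deriv_le
    (F := fun s θ => G (θ, s)) (F' := fun s θ => G' (θ, s)) (bound := fun _ => C)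
    (s := Ioo 0 t₁) (Ioo_mem_nhds ht.1 ht₁) ?_ ?_ ?_ ?_ ?_ ?_).2
  · filter_upwards [Ioo_mem_nhds ht.1 ht.2] with s hs
    exact (hcont hG s hs).aestronglyMeasurable
  · exact (hcont hG t ht).intervalIntegrable _ _
  · exact (hcont hG' t ht).aestronglyMeasurable
  · refine .of_forall fun θ hθ s hs => ?_
    rw [uIoc_of_le hab] at hθ
    exact hC s (Ioo_subset_Icc_self hs) θ (Ioc_subset_Icc_self hθ)
  · exact intervalIntegrable_const
  · exact .of_forall fun θ _ s hs => hd θ s ⟨hs.1, hs.2.trans ht₁T⟩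

theorem continuousOn_fCoeff {T : ℝ} {F : ℝ × ℝ → ℝ} (hF : ContinuousOn F (univ ×ˢ Ico 0 T))
    (n : ℤ) : ContinuousOn (fun t => fCoeff (fun θ => F (θ, t)) n) (Ico 0 T) := by
  refine continuousOn_const.mul (continuousOn_intervalIntegral_strip
    (G := fun q => (F q : ℂ) * Complex.exp (-(Complex.I * n * q.1))) ?_ _ _)
  exact (Complex.continuous_ofReal.comp_continuousOn hF).mul (by fun_prop)

theorem hasDerivAt_fCoeff {T : ℝ} {F F' : ℝ × ℝ → ℝ} (hF : ContinuousOn F (univ ×ˢ Ico 0 T))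
    (hF' : ContinuousOn F' (univ ×ˢ Ico 0 T))
    (hd : ∀ θ, ∀ t ∈ Ioo 0 T, HasDerivAt (fun s => F (θ, s)) (F' (θ, t)) t) (n : ℤ)
    {t : ℝ} (ht : t ∈ Ioo 0 T) :
    HasDerivAt (fun s => fCoeff (fun θ => F (θ, s)) n) (fCoeff (fun θ => F' (θ, t)) n) t := by
  refine (hasDerivAt_intervalIntegral_strip
    (G := fun q => (F q : ℂ) * Complex.exp (-(Complex.I * n * q.1)))
    (G' := fun q => (F' q : ℂ) * Complex.exp (-(Complex.I * n * q.1)))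
    ?_ ?_ ?_ two_pi_pos.le ht).const_mul _
  · exact (Complex.continuous_ofReal.comp_continuousOn hF).mul (by fun_prop)
  · exact (Complex.continuous_ofReal.comp_continuousOn hF').mul (by fun_prop)
  · exact fun θ s hs => (hd θ s hs).ofReal_comp.mul_const (Complex.exp (-(Complex.I * n * θ)))

theorem summable_one_div_one_add_sq : Summable fun n : ℤ => 1 / (1 + (n : ℝ) ^ 2) := by
  have h : Summable fun n : ℤ => 1 / (n : ℝ) ^ 2 := Real.summable_one_div_int_pow.2 one_lt_two
  refine Summable.of_norm_bounded_eventually h ?_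
  filter_upwards [(Set.finite_singleton (0 : ℤ)).compl_mem_cofinite] with n hn
  have hn' : (0 : ℝ) < (n : ℝ) ^ 2 := by
    have : (n : ℝ) ≠ 0 := by exact_mod_cast hn
    positivity
  rw [Real.norm_of_nonneg (by positivity)]
  exact one_div_le_one_div_of_le hn' (by linarith)

namespace IsSmoothFamily

variable {T : ℝ} {F : ℝ × ℝ → ℝ}

theorem hasDerivAt_space (hF : IsSmoothFamily T F) (θ : ℝ) {t : ℝ} (ht : t ∈ Ico 0 T) :
    HasDerivAt (fun x => F (x, t)) (spaceDeriv T F (θ, t)) θ := by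
  have hmem : (θ, t) ∈ (univ : Set ℝ) ×ˢ Ico 0 T := ⟨mem_univ _, ht⟩
  have h := ((hF.smooth.differentiableOn (by simp)) (θ, t) hmem).hasFDerivWithinAt
  have h' : HasDerivWithinAt (fun x : ℝ => (x, t)) ((1 : ℝ), (0 : ℝ)) univ θ :=
    ((hasDerivAt_id θ).prodMk (hasDerivAt_const θ t)).hasDerivWithinAt
  have hmaps : MapsTo (fun x : ℝ => (x, t)) univ ((univ : Set ℝ) ×ˢ Ico 0 T) :=
    fun x _ => ⟨mem_univ _, ht⟩
  exact hasDerivWithinAt_univ.1 (h.comp_hasDerivWithinAt θ h' hmaps)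

theorem spaceDeriv (hF : IsSmoothFamily T F) : IsSmoothFamily T (spaceDeriv T F) where
  smooth := by
    have h := hF.smooth.fderivWithin (m := ((⊤ : ℕ∞) : WithTop ℕ∞)) (uniqueDiffOn_strip T) (by simp)
    exact h.clm_apply contDiffOn_const
  periodic θ t ht := by
    have h := (hF.hasDerivAt_space (θ + 2 * π) ht).comp_add_const θ (2 * π)
    exact h.unique ((hF.hasDerivAt_space θ ht).congr_of_eventuallyEq
      (.of_forall fun x => hF.periodic x t ht))

theorem continuousOn (hF : IsSmoothFamily T F) : ContinuousOn F (univ ×ˢ Ico 0 T) :=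
  hF.smooth.continuousOn

theorem continuous_space (hF : IsSmoothFamily T F) {t : ℝ} (ht : t ∈ Ico 0 T) :
    Continuous fun θ => F (θ, t) :=
  hF.continuousOn.comp_continuous (by fun_prop) fun _ => ⟨mem_univ _, ht⟩

/-- Quadratic decay of the Fourier coefficients, uniformly on compact time intervals. -/
theorem exists_norm_fCoeff_le (hF : IsSmoothFamily T F) {t₁ : ℝ} (ht₁ : t₁ < T) :
    ∃ C, 0 ≤ C ∧ ∀ t ∈ Icc 0 t₁, ∀ n : ℤ,
      ‖fCoeff (fun θ => F (θ, t)) n‖ ≤ C * (1 / (1 + (n : ℝ) ^ 2)) := by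
  obtain ⟨A, hA⟩ := exists_bound_strip ht₁ hF.continuousOn 0 (2 * π)
  obtain ⟨B, hB⟩ := exists_bound_strip ht₁ hF.spaceDeriv.spaceDeriv.continuousOn 0 (2 * π)
  refine ⟨max (A + B) 0, le_max_right _ _, fun t ht n => ?_⟩
  have htT : t ∈ Ico 0 T := ⟨ht.1, ht.2.trans_lt ht₁⟩
  have h0 := norm_fCoeff_le (hA t ht) n
  have h2 := norm_fCoeff_le (hB t ht) n
  rw [fCoeff_deriv_deriv (fun θ => hF.hasDerivAt_space θ htT)
    (fun θ => hF.spaceDeriv.hasDerivAt_space θ htT) (hF.spaceDeriv.spaceDeriv.continuous_space htT)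
    (by simpa using hF.periodic 0 t htT) (by simpa using hF.spaceDeriv.periodic 0 t htT)] at h2
  rw [norm_mul, norm_neg, norm_pow, Complex.norm_intCast, sq_abs] at h2
  rw [mul_one_div, le_div_iff₀ (by positivity)]
  nlinarith [le_max_left (A + B) 0]

end IsSmoothFamily

/-- The right-hand side of the `p`-curve shortening equation along `k`, as a function on
`ℝ × [0, T)`. -/
noncomputable def flowRate (p : ℕ) (T : ℝ) (k : ℝ → ℝ → ℝ) (q : ℝ × ℝ) : ℝ :=
  curvatureRate p (k q.1 q.2) (spaceDeriv T (fun q => k q.1 q.2) q)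
    (spaceDeriv T (spaceDeriv T fun q => k q.1 q.2) q)

/-- The mean over the period of the radius of curvature `1 / k (·, t)`. -/
noncomputable def meanRadius (k : ℝ → ℝ → ℝ) (t : ℝ) : ℝ :=
  1 / (2 * π) * ∫ θ in (0 : ℝ)..(2 * π), (k θ t)⁻¹

namespace IsPCSF

variable {p : ℕ} {T : ℝ} {k : ℝ → ℝ → ℝ} {ψ : ℝ → ℝ}

theorem isSmoothFamily (h : IsPCSF p T k ψ) : IsSmoothFamily T fun q => k q.1 q.2 :=
  ⟨h.1, fun θ t _ => h.2.1 θ t⟩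

theorem isSmoothFamily_flowRate (h : IsPCSF p T k ψ) : IsSmoothFamily T (flowRate p T k) where
  smooth := by
    have h0 := h.isSmoothFamily.smooth
    have h1 := h.isSmoothFamily.spaceDeriv.smooth
    have h2 := h.isSmoothFamily.spaceDeriv.spaceDeriv.smooth
    exact (h0.pow 2).mul ((((h0.pow (p - 1)).mul h2).add
      ((contDiffOn_const.mul (h0.pow (p - 2))).mul (h1.pow 2))).add
      (contDiffOn_const.mul (h0.pow p)))
  periodic θ t ht := by
    have h0 := h.isSmoothFamily.periodic θ t ht
    have h1 := h.isSmoothFamily.spaceDeriv.periodic θ t ht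
    have h2 := h.isSmoothFamily.spaceDeriv.spaceDeriv.periodic θ t ht
    simp only at h0
    simp only [flowRate, h0, h1, h2]

theorem pos (h : IsPCSF p T k ψ) (θ : ℝ) {t : ℝ} (ht : t ∈ Ico 0 T) : 0 < k θ t :=
  h.2.2.1 θ t ht

theorem hasDerivAt_time (h : IsPCSF p T k ψ) (θ : ℝ) {t : ℝ} (ht : t ∈ Ico 0 T) :
    HasDerivAt (fun s => k θ s) (flowRate p T k (θ, t)) t := by
  have h1 : deriv (fun x => k x t) = fun θ => spaceDeriv T (fun q => k q.1 q.2) (θ, t) :=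
    funext fun θ => (h.isSmoothFamily.hasDerivAt_space θ ht).deriv
  have h2 := (h.isSmoothFamily.spaceDeriv.hasDerivAt_space θ ht).deriv
  have := h.2.2.2.1 θ t ht
  rwa [h1, h2] at this

theorem continuousOn_inv (h : IsPCSF p T k ψ) :
    ContinuousOn (fun q : ℝ × ℝ => (k q.1 q.2)⁻¹) (univ ×ˢ Ico 0 T) :=
  h.isSmoothFamily.continuousOn.inv₀ fun q hq => (h.pos q.1 hq.2).ne'

theorem continuous_space (h : IsPCSF p T k ψ) {t : ℝ} (ht : t ∈ Ico 0 T) :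
    Continuous fun θ => k θ t :=
  h.isSmoothFamily.continuous_space ht

theorem continuous_inv_space (h : IsPCSF p T k ψ) {t : ℝ} (ht : t ∈ Ico 0 T) :
    Continuous fun θ => (k θ t)⁻¹ :=
  (h.continuous_space ht).inv₀ fun θ => (h.pos θ ht).ne'

theorem meanRadius_pos (h : IsPCSF p T k ψ) {t : ℝ} (ht : t ∈ Ico 0 T) : 0 < meanRadius k t := by
  refine mul_pos (by positivity) (intervalIntegral.intervalIntegral_pos_of_pos
    ((h.continuous_inv_space ht).intervalIntegrable _ _) (fun θ => inv_pos.2 (h.pos θ ht))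
    two_pi_pos)

theorem continuousOn_meanRadius (h : IsPCSF p T k ψ) : ContinuousOn (meanRadius k) (Ico 0 T) :=
  continuousOn_const.mul (continuousOn_intervalIntegral_strip h.continuousOn_inv _ _)

theorem hasDerivAt_meanRadius (h : IsPCSF p T k ψ) (hp : 1 ≤ p) {t : ℝ} (ht : t ∈ Ioo 0 T) :
    HasDerivAt (meanRadius k)
      (-(1 / (2 * π) * ∫ θ in (0 : ℝ)..(2 * π), 1 / (p : ℝ) * k θ t ^ p)) t := by
  have ht' : t ∈ Ico 0 T := Ioo_subset_Ico_self ht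
  have hd := hasDerivAt_intervalIntegral_strip h.continuousOn_inv
    (G' := fun q => -flowRate p T k q / k q.1 q.2 ^ 2)
    (h.isSmoothFamily_flowRate.continuousOn.neg.div (h.isSmoothFamily.continuousOn.pow 2)
      fun q hq => (pow_pos (h.pos q.1 hq.2) 2).ne')
    (fun θ s hs => (h.hasDerivAt_time θ (Ioo_subset_Ico_self hs)).inv
      (h.pos θ (Ioo_subset_Ico_self hs)).ne') two_pi_pos.le ht
  refine (hd.const_mul (1 / (2 * π))).congr_deriv ?_
  rw [← mul_neg, ← intervalIntegral.integral_neg]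
  congr 1
  rw [← sub_eq_zero, ← intervalIntegral.integral_sub]
  · set k₁ := spaceDeriv T (fun q => k q.1 q.2)
    have hk := h.isSmoothFamily.hasDerivAt_space (t := t)
    have hk₁ := h.isSmoothFamily.spaceDeriv.hasDerivAt_space (t := t)
    have hprim : ∀ θ ∈ uIcc 0 (2 * π), HasDerivAt (fun θ => -(k θ t ^ (p - 1) * k₁ (θ, t)))
        (-flowRate p T k (θ, t) / k θ t ^ 2 - -(1 / (p : ℝ) * k θ t ^ p)) θ := fun θ _ => by
      refine (((hk θ ht').pow (p - 1)).mul (hk₁ θ ht')).neg.congr_deriv ?_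
      have := (h.pos θ ht').ne'
      obtain ⟨m, rfl⟩ := Nat.exists_eq_add_of_le hp
      simp only [flowRate, curvatureRate]
      rw [show 1 + m - 1 = m by omega, show 1 + m - 2 = m - 1 by omega]
      simp only [Pi.pow_apply]
      push_cast
      field_simp
      ring
    rw [intervalIntegral.integral_eq_sub_of_hasDerivAt hprim]
    · have h0 := h.2.1 0 t
      have h1 := h.isSmoothFamily.spaceDeriv.periodic 0 t ht'
      rw [zero_add] at h0 h1
      simp only [k₁, h0, h1, sub_self]
    · refine Continuous.intervalIntegrable ?_ _ _
      exact ((h.isSmoothFamily_flowRate.continuous_space ht').neg.div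
        ((h.continuous_space ht').pow 2) fun θ => (pow_pos (h.pos θ ht') 2).ne').sub
        (continuous_const.mul ((h.continuous_space ht').pow p)).neg
  · exact ((h.isSmoothFamily_flowRate.continuous_space ht').neg.div
        ((h.continuous_space ht').pow 2) fun θ =>
          (pow_pos (h.pos θ ht') 2).ne').intervalIntegrable _ _
  · exact (continuous_const.mul ((h.continuous_space ht').pow p)).neg.intervalIntegrable _ _

theorem exists_hasDerivAt_meanRadius (h : IsPCSF p T k ψ) (hp : 1 ≤ p) {t : ℝ}
    (ht : t ∈ Ioo 0 T) : ∃ D, HasDerivAt (meanRadius k) D t ∧ D ≤ 0 ∧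
      ∀ M, (∀ θ, k θ t ≤ M) → -M ^ p ≤ D := by
  have ht' : t ∈ Ico 0 T := Ioo_subset_Ico_self ht
  have hp' : (1 : ℝ) ≤ p := by exact_mod_cast hp
  refine ⟨_, h.hasDerivAt_meanRadius hp ht, ?_, fun M hM => ?_⟩
  · refine neg_nonpos.2 (mul_nonneg (by positivity)
      (intervalIntegral.integral_nonneg two_pi_pos.le fun θ _ => ?_))
    have := h.pos θ ht'
    positivity
  · refine neg_le_neg ?_
    have hle : ∫ θ in (0 : ℝ)..(2 * π), 1 / (p : ℝ) * k θ t ^ p ≤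
        ∫ θ in (0 : ℝ)..(2 * π), M ^ p := by
      refine intervalIntegral.integral_mono_on two_pi_pos.le
        ((continuous_const.mul ((h.continuous_space ht').pow p)).intervalIntegrable _ _)
        intervalIntegrable_const fun θ _ => ?_
      have h1 : k θ t ^ p ≤ M ^ p := pow_le_pow_left₀ (h.pos θ ht').le (hM θ) p
      have h2 : 0 ≤ k θ t ^ p := (pow_pos (h.pos θ ht') p).le
      calc 1 / (p : ℝ) * k θ t ^ p ≤ 1 * k θ t ^ p :=
            mul_le_mul_of_nonneg_right ((div_le_one (by linarith)).2 hp') h2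
        _ ≤ M ^ p := by linarith
    rw [intervalIntegral.integral_const, smul_eq_mul, sub_zero] at hle
    calc _ ≤ 1 / (2 * π) * (2 * π * M ^ p) := mul_le_mul_of_nonneg_left hle (by positivity)
      _ = M ^ p := by field_simp

theorem antitoneOn_meanRadius (h : IsPCSF p T k ψ) (hp : 1 ≤ p) :
    AntitoneOn (meanRadius k) (Ico 0 T) := by
  refine antitoneOn_of_deriv_nonpos (convex_Ico 0 T) h.continuousOn_meanRadius ?_ ?_ <;>
    rw [interior_Ico] <;> intro t ht <;>
    obtain ⟨D, hD, hD0, -⟩ := h.exists_hasDerivAt_meanRadius hp ht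
  · exact hD.differentiableAt.differentiableWithinAt
  · rwa [hD.deriv]

theorem fCoeff_inv (h : IsPCSF p T k ψ) {t : ℝ} (ht : t ∈ Ico 0 T) {n : ℤ} (hn : |n| ≤ 1) :
    fCoeff (fun θ => (k θ t)⁻¹) n = if n = 0 then (meanRadius k t : ℂ) else 0 := by
  have hclose := h.2.2.2.2.2.2.2.2.2 t ht
  have hint : ∫ θ in (0 : ℝ)..(2 * π), ((k θ t)⁻¹ : ℂ) * Complex.exp (Complex.I * θ) = 0 := by
    rw [← hclose]
    exact intervalIntegral.integral_congr fun θ _ => by rw [mul_comm, div_eq_mul_inv]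
  have hn' : n = -1 ∨ n = 0 ∨ n = 1 := by rw [abs_le] at hn; omega
  rcases hn' with rfl | rfl | rfl
  · rw [if_neg (by norm_num), fCoeff]
    simp only [Complex.ofReal_inv]
    simp only [Int.cast_neg, Int.cast_one, mul_neg, neg_mul, neg_neg, mul_one]
    rw [hint, mul_zero]
  · rw [if_pos rfl, fCoeff, meanRadius]
    simp only [Int.cast_zero, mul_zero, zero_mul, neg_zero, Complex.exp_zero, mul_one]
    rw [intervalIntegral.integral_ofReal]
    push_cast
    rfl
  · rw [if_neg (by norm_num), fCoeff]
    have hconj : ∫ θ in (0 : ℝ)..(2 * π), (((k θ t)⁻¹ : ℝ) : ℂ) *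
        Complex.exp (-(Complex.I * ((1 : ℤ) : ℂ) * θ)) =
        (starRingEnd ℂ)
          (∫ θ in (0 : ℝ)..(2 * π), ((k θ t)⁻¹ : ℂ) * Complex.exp (Complex.I * θ)) := by
      rw [intervalIntegral.integral_of_le two_pi_pos.le,
        intervalIntegral.integral_of_le two_pi_pos.le,
        ← integral_conj]
      refine integral_congr_ae (.of_forall fun θ => ?_)
      simp [← Complex.exp_conj]
    rw [hconj, hint, map_zero, mul_zero]

end IsPCSF

/-- The weight `e^{α t min(|n|, N)}`. -/
noncomputable def truncWeight (α : ℝ) (N : ℕ) (t : ℝ) (n : ℤ) : ℝ :=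
  exp (α * t * min |(n : ℝ)| N)

theorem truncWeight_pos (α : ℝ) (N : ℕ) (t : ℝ) (n : ℤ) : 0 < truncWeight α N t n := exp_pos _

theorem truncWeight_at_zero (α : ℝ) (N : ℕ) (n : ℤ) : truncWeight α N 0 n = 1 := by
  simp [truncWeight]

theorem isFourierWeight_truncWeight {α t : ℝ} (hα : 0 ≤ α * t) (N : ℕ) :
    IsFourierWeight (truncWeight α N t) where
  one_le n := one_le_exp (mul_nonneg hα (le_min (abs_nonneg _) N.cast_nonneg))
  zero := by simp [truncWeight]
  add_le m n := by
    rw [truncWeight, truncWeight, truncWeight, ← exp_add, ← mul_add]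
    refine exp_le_exp.2 (mul_le_mul_of_nonneg_left ?_ hα)
    have hN : (0 : ℝ) ≤ N := N.cast_nonneg
    have h := abs_add_le (m : ℝ) n
    push_cast
    rcases le_total |(m : ℝ)| N with hm | hm <;> rcases le_total |(n : ℝ)| N with hn | hn <;>
      simp only [hm, hn, min_eq_left, min_eq_right]
    · exact (min_le_left _ _).trans h
    · exact (min_le_right _ _).trans (by linarith [abs_nonneg (m : ℝ)])
    · exact (min_le_right _ _).trans (by linarith [abs_nonneg (n : ℝ)])
    · exact (min_le_right _ _).trans (by linarith)

theorem truncWeight_le {α t t₁ : ℝ} (hα : 0 ≤ α) (ht₁ : t ≤ t₁) (ht : 0 ≤ t) (N : ℕ) (n : ℤ) :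
    truncWeight α N t n ≤ exp (α * t₁ * N) := by
  refine exp_le_exp.2 (mul_le_mul (mul_le_mul_of_nonneg_left ht₁ hα) (min_le_right _ _)
    (le_min (abs_nonneg _) N.cast_nonneg) (mul_nonneg hα (ht.trans ht₁)))

theorem truncWeight_le_two {α t : ℝ} (hα : 0 ≤ α * t) (h : α * t ≤ log 2) (N : ℕ) {n : ℤ}
    (hn : |n| ≤ 1) : truncWeight α N t n ≤ 2 := by
  have hn' : |(n : ℝ)| ≤ 1 := by exact_mod_cast hn
  refine (exp_le_exp.2 ?_).trans_eq (exp_log zero_lt_two)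
  have := mul_le_mul_of_nonneg_left ((min_le_left |(n : ℝ)| (N : ℝ)).trans hn') hα
  linarith

theorem hasDerivAt_truncWeight (α : ℝ) (N : ℕ) (n : ℤ) (t : ℝ) :
    HasDerivAt (fun s => truncWeight α N s n) (α * min |(n : ℝ)| N * truncWeight α N t n) t := by
  have h := ((((hasDerivAt_id t).const_mul α).mul_const (min |(n : ℝ)| N))).exp
  refine h.congr_deriv ?_
  simp only [truncWeight, id, mul_one]
  ring

theorem continuous_truncWeight (α : ℝ) (N : ℕ) (n : ℤ) :
    Continuous fun s => truncWeight α N s n :=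
  continuous_iff_continuousAt.2 fun t => (hasDerivAt_truncWeight α N n t).continuousAt

theorem continuousOn_tsum_of_locally_bounded {T : ℝ} {g : ℤ → ℝ → ℝ} {u : ℤ → ℝ}
    (hu : Summable u) (hg : ∀ n, ContinuousOn (g n) (Ico 0 T))
    (hb : ∀ t₁ < T, ∃ C, ∀ t ∈ Icc 0 t₁, ∀ n, ‖g n t‖ ≤ C * u n) :
    ContinuousOn (fun t => ∑' n, g n t) (Ico 0 T) := by
  intro t ht
  obtain ⟨t₁, htt₁, ht₁⟩ := exists_between ht.2
  obtain ⟨C, hC⟩ := hb t₁ ht₁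
  have h := continuousOn_tsum (fun n => (hg n).mono (Ico_subset_Ico_right ht₁.le))
    (hu.mul_left C) fun n s hs => hC s (Ico_subset_Icc_self hs) n
  refine (h t ⟨ht.1, htt₁⟩).mono_of_mem_nhdsWithin ?_
  filter_upwards [self_mem_nhdsWithin, mem_nhdsWithin_of_mem_nhds (Iio_mem_nhds htt₁)] with s h1 h2
  exact ⟨h1.1, h2⟩

/-- A continuous function, positive at `0`, which cannot vanish for a first time, stays positive. -/
theorem pos_of_no_first_zero {T : ℝ} {f : ℝ → ℝ} (hf : ContinuousOn f (Ico 0 T)) (h0 : 0 < f 0)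
    (hstep : ∀ t ∈ Ioo 0 T, (∀ s ∈ Ico 0 t, 0 < f s) → f t ≠ 0) : ∀ t ∈ Ico 0 T, 0 < f t := by
  intro t ht
  by_contra! hneg
  have hzero : ∀ s ∈ Ico 0 T, f s ≤ 0 → ∃ r ∈ Icc 0 s, f r = 0 := fun s hs hfs =>
    intermediate_value_Icc' hs.1 (hf.mono (Icc_subset_Ico_right hs.2)) ⟨hfs, h0.le⟩
  have hcl : IsCompact {s ∈ Icc 0 t | f s = 0} := by
    refine isCompact_Icc.of_isClosed_subset ?_ (sep_subset _ _)
    exact (hf.mono (Icc_subset_Ico_right ht.2)).preimage_isClosed_of_isClosed isClosed_Icc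
      isClosed_singleton
  obtain ⟨r, hr, hfr⟩ := hzero t ht hneg
  obtain ⟨z, ⟨hz, hfz⟩, hleast⟩ := hcl.exists_isLeast ⟨r, hr, hfr⟩
  have hz0 : z ≠ 0 := by rintro rfl; exact h0.ne' hfz
  refine hstep z ⟨lt_of_le_of_ne hz.1 hz0.symm, hz.2.trans_lt ht.2⟩ (fun s hs => ?_) hfz
  by_contra! hs0
  obtain ⟨r', hr', hfr'⟩ := hzero s ⟨hs.1, hs.2.trans_le (hz.2.trans ht.2.le)⟩ hs0
  exact absurd (hleast ⟨⟨hr'.1, hr'.2.trans (hs.2.le.trans hz.2)⟩, hfr'⟩)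
    (by linarith [hr'.2, hs.2])

theorem deriv_nonpos_of_nonneg_left {f : ℝ → ℝ} {f' t a : ℝ} (hat : a < t)
    (hd : HasDerivAt f f' t) (hft : f t = 0) (hf : ∀ s ∈ Ioo a t, 0 ≤ f s) : f' ≤ 0 := by
  have h := (hasDerivWithinAt_iff_tendsto_slope' (self_notMem_Iio (a := t))).1
    (hd.hasDerivWithinAt (s := Iio t))
  refine le_of_tendsto h ?_
  filter_upwards [Ioo_mem_nhdsLT hat] with s hs
  rw [slope_def_field, hft, sub_zero]
  exact div_nonpos_of_nonneg_of_nonpos (hf s hs) (by linarith [hs.2])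

/-- The weighted `ℓ¹` norm of the frequencies of `k (·, t)` other than `0, ±1`. -/
noncomputable def highEnergy (α : ℝ) (N : ℕ) (k : ℝ → ℝ → ℝ) (t : ℝ) : ℝ :=
  ∑' n, highMode n * (truncWeight α N t n * ‖fCoeff (fun θ => k θ t) n‖)

/-- The weighted `ℓ¹` norm of the oscillation of `k (·, t)` around its harmonic mean. -/
noncomputable def weightedOscillation (α : ℝ) (N : ℕ) (k : ℝ → ℝ → ℝ) (t : ℝ) : ℝ :=
  ∑' n, truncWeight α N t n * ‖fCoeff (fun θ => k θ t - (meanRadius k t)⁻¹) n‖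

theorem IsSmoothFamily.exists_truncWeight_mul_le {T : ℝ} {F : ℝ × ℝ → ℝ} (hF : IsSmoothFamily T F)
    {α : ℝ} (hα : 0 ≤ α) (N : ℕ) {t₁ : ℝ} (ht₁ : t₁ < T) :
    ∃ C, 0 ≤ C ∧ ∀ t ∈ Icc 0 t₁, ∀ n : ℤ,
      truncWeight α N t n * ‖fCoeff (fun θ => F (θ, t)) n‖ ≤ C * (1 / (1 + (n : ℝ) ^ 2)) := by
  obtain ⟨C, hC0, hC⟩ := hF.exists_norm_fCoeff_le ht₁
  refine ⟨exp (α * t₁ * N) * C, by positivity, fun t ht n => ?_⟩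
  rw [mul_assoc]
  exact mul_le_mul (truncWeight_le hα ht.2 ht.1 N n) (hC t ht n) (norm_nonneg _) (exp_pos _).le

theorem IsSmoothFamily.summable_truncWeight_mul {T : ℝ} {F : ℝ × ℝ → ℝ} (hF : IsSmoothFamily T F)
    {α : ℝ} (hα : 0 ≤ α) (N : ℕ) {t : ℝ} (ht : t ∈ Ico 0 T) :
    Summable fun n => truncWeight α N t n * ‖fCoeff (fun θ => F (θ, t)) n‖ := by
  obtain ⟨C, -, hC⟩ := hF.exists_truncWeight_mul_le hα N ht.2
  exact .of_nonneg_of_le (fun n => mul_nonneg (truncWeight_pos α N t n).le (norm_nonneg _))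
    (hC t ⟨ht.1, le_rfl⟩) (summable_one_div_one_add_sq.mul_left C)

namespace IsPCSF

variable {p : ℕ} {T : ℝ} {k : ℝ → ℝ → ℝ} {ψ : ℝ → ℝ} {α : ℝ}

theorem summable_truncWeight_mul (h : IsPCSF p T k ψ) (hα : 0 ≤ α) (N : ℕ) {t : ℝ}
    (ht : t ∈ Ico 0 T) : Summable fun n => truncWeight α N t n * ‖fCoeff (fun θ => k θ t) n‖ :=
  h.isSmoothFamily.summable_truncWeight_mul hα N ht

theorem continuousOn_highEnergy (h : IsPCSF p T k ψ) (hα : 0 ≤ α) (N : ℕ) :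
    ContinuousOn (highEnergy α N k) (Ico 0 T) := by
  refine continuousOn_tsum_of_locally_bounded summable_one_div_one_add_sq (fun n => ?_)
    fun t₁ ht₁ => ?_
  · exact continuousOn_const.mul ((continuous_truncWeight α N n).continuousOn.mul
      (continuousOn_fCoeff h.isSmoothFamily.continuousOn n).norm)
  · obtain ⟨C, -, hC⟩ := h.isSmoothFamily.exists_truncWeight_mul_le hα N ht₁
    refine ⟨C, fun t ht n => ?_⟩
    refine (abs_norm_highMode_le n _).trans ?_
    rw [abs_of_nonneg (mul_nonneg (truncWeight_pos α N t n).le (norm_nonneg _))]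
    exact hC t ht n

theorem continuousOn_weightedOscillation (h : IsPCSF p T k ψ) (hα : 0 ≤ α) (N : ℕ) :
    ContinuousOn (weightedOscillation α N k) (Ico 0 T) := by
  have hterm : ∀ n : ℤ, ContinuousOn (fun t => truncWeight α N t n *
      ‖fCoeff (fun θ => k θ t - (meanRadius k t)⁻¹) n‖) (Ico 0 T) := fun n => by
    refine (continuous_truncWeight α N n).continuousOn.mul (continuousOn_fCoeff
      (F := fun q => k q.1 q.2 - (meanRadius k q.2)⁻¹)
      (h.isSmoothFamily.continuousOn.sub ?_) n).norm
    exact (h.continuousOn_meanRadius.comp continuousOn_snd fun q hq => hq.2).inv₀ fun q hq =>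
      (h.meanRadius_pos hq.2).ne'
  refine ((h.continuousOn_highEnergy hα N).add
    (((hterm (-1)).add (hterm 0)).add (hterm 1))).congr fun t ht => ?_
  have hk := h.continuous_space ht
  rw [weightedOscillation, tsum_eq_highMode_add
    (summable_fCoeff_sub_const hk _ (h.summable_truncWeight_mul hα N ht))]
  simp only [highMode_mul_fCoeff_sub_const hk _ (truncWeight α N t)]
  rfl

/-- The time derivative of the energy tested against a fixed sign pattern `σ`. -/
theorem hasDerivAt_testedEnergy (h : IsPCSF p T k ψ) (hα : 0 ≤ α) (N : ℕ) {t : ℝ}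
    (ht : t ∈ Ioo 0 T) {σ : ℤ → ℂ} (hσ : ∀ n, ‖σ n‖ ≤ 1) :
    (Summable fun n => highMode n * (α * min |(n : ℝ)| N * (truncWeight α N t n *
        (σ n * fCoeff (fun θ => k θ t) n).re) + truncWeight α N t n *
        (σ n * fCoeff (fun θ => flowRate p T k (θ, t)) n).re)) ∧
    HasDerivAt (fun s => ∑' n, highMode n * (truncWeight α N s n *
        (σ n * fCoeff (fun θ => k θ s) n).re))
      (∑' n, highMode n * (α * min |(n : ℝ)| N * (truncWeight α N t n *
        (σ n * fCoeff (fun θ => k θ t) n).re) + truncWeight α N t n *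
        (σ n * fCoeff (fun θ => flowRate p T k (θ, t)) n).re)) t := by
  obtain ⟨t₁, htt₁, ht₁⟩ := exists_between ht.2
  obtain ⟨A, hA0, hA⟩ := h.isSmoothFamily.exists_truncWeight_mul_le hα N ht₁
  obtain ⟨B, hB0, hB⟩ := h.isSmoothFamily_flowRate.exists_truncWeight_mul_le hα N ht₁
  have hre : ∀ (n : ℤ) (s : ℝ) (z : ℂ), |truncWeight α N s n * (σ n * z).re| ≤
      truncWeight α N s n * ‖z‖ := fun n s z => by
    rw [abs_mul, abs_of_pos (truncWeight_pos α N s n)]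
    refine mul_le_mul_of_nonneg_left ((Complex.abs_re_le_norm _).trans ?_)
      (truncWeight_pos α N s n).le
    rw [norm_mul]
    exact mul_le_of_le_one_left (norm_nonneg _) (hσ n)
  have hbound : ∀ (n : ℤ), ∀ s ∈ Ioo 0 t₁,
      ‖highMode n * (α * min |(n : ℝ)| N * (truncWeight α N s n *
        (σ n * fCoeff (fun θ => k θ s) n).re) + truncWeight α N s n *
        (σ n * fCoeff (fun θ => flowRate p T k (θ, s)) n).re)‖ ≤
      (α * N * A + B) * (1 / (1 + (n : ℝ) ^ 2)) := fun n s hs => by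
    have hs' := Ioo_subset_Icc_self hs
    refine (abs_norm_highMode_le n _).trans ((abs_add_le _ _).trans ?_)
    have hm : 0 ≤ min |(n : ℝ)| N := le_min (abs_nonneg _) N.cast_nonneg
    rw [abs_mul, abs_of_nonneg (mul_nonneg hα hm), add_mul, mul_assoc (α * N) A]
    refine add_le_add (mul_le_mul (mul_le_mul_of_nonneg_left (min_le_right _ _) hα)
      ((hre n s _).trans (hA s hs' n)) (abs_nonneg _) (by positivity))
      ((hre n s _).trans (hB s hs' n))
  have hsum := summable_one_div_one_add_sq.mul_left (α * N * A + B)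
  have htmem : t ∈ Ioo 0 t₁ := ⟨ht.1, htt₁⟩
  refine ⟨.of_norm_bounded hsum fun n => hbound n t htmem, ?_⟩
  refine hasDerivAt_tsum_of_isPreconnected hsum isOpen_Ioo isPreconnected_Ioo
    (fun n s hs => ?_) hbound htmem ?_ htmem
  · have hc := hasDerivAt_fCoeff h.isSmoothFamily.continuousOn
      h.isSmoothFamily_flowRate.continuousOn
      (fun θ r hr => h.hasDerivAt_time θ (Ioo_subset_Ico_self hr)) n ⟨hs.1, hs.2.trans ht₁⟩
    have hc' := Complex.reCLM.hasFDerivAt.comp_hasDerivAt s (hc.const_mul (σ n))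
    refine (((hasDerivAt_truncWeight α N n s).mul hc').const_mul (highMode n)).congr_deriv ?_
    simp only [Complex.reCLM_apply, Function.comp_apply]
    ring
  · refine .of_norm_bounded (h.summable_truncWeight_mul hα N (Ioo_subset_Ico_self ht)) fun n => ?_
    exact (abs_norm_highMode_le n _).trans (hre n t _)

end IsPCSF

/-- The upper barrier for the energy of the frequencies other than `0, ±1`. -/
noncomputable def energyBarrier (κ q : ℝ) (k : ℝ → ℝ → ℝ) (t : ℝ) : ℝ :=
  κ * (meanRadius k 0)⁻¹ * (meanRadius k t / meanRadius k 0) ^ q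

namespace IsPCSF

variable {p : ℕ} {T : ℝ} {k : ℝ → ℝ → ℝ} {ψ : ℝ → ℝ} {α κ q : ℝ}

theorem meanRadius_le_initial (h : IsPCSF p T k ψ) (hp : 1 ≤ p) {t : ℝ} (ht : t ∈ Ico 0 T) :
    meanRadius k t ≤ meanRadius k 0 :=
  h.antitoneOn_meanRadius hp ⟨le_rfl, ht.1.trans_lt ht.2⟩ ht ht.1

theorem energyBarrier_pos (h : IsPCSF p T k ψ) (hκ : 0 < κ) {t : ℝ} (ht : t ∈ Ico 0 T) :
    0 < energyBarrier κ q k t := by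
  have h0 := h.meanRadius_pos ⟨le_rfl, ht.1.trans_lt ht.2⟩
  have h1 := h.meanRadius_pos ht
  exact mul_pos (mul_pos hκ (inv_pos.2 h0)) (rpow_pos_of_pos (div_pos h1 h0) _)

theorem energyBarrier_le (h : IsPCSF p T k ψ) (hp : 1 ≤ p) (hκ : 0 < κ) (hq : 0 ≤ q) {t : ℝ}
    (ht : t ∈ Ico 0 T) : energyBarrier κ q k t ≤ κ * (meanRadius k t)⁻¹ := by
  have h0 := h.meanRadius_pos ⟨le_rfl, ht.1.trans_lt ht.2⟩
  have h1 := h.meanRadius_pos ht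
  have hle := h.meanRadius_le_initial hp ht
  calc energyBarrier κ q k t ≤ κ * (meanRadius k 0)⁻¹ * 1 :=
        mul_le_mul_of_nonneg_left (rpow_le_one (div_pos h1 h0).le ((div_le_one h0).2 hle) hq)
          (by positivity)
    _ ≤ κ * (meanRadius k t)⁻¹ := by
        rw [mul_one]
        exact mul_le_mul_of_nonneg_left ((inv_le_inv₀ h0 h1).2 hle) hκ.le

theorem continuousOn_energyBarrier (h : IsPCSF p T k ψ) (hT : 0 < T) :
    ContinuousOn (energyBarrier κ q k) (Ico 0 T) :=
  continuousOn_const.mul ((h.continuousOn_meanRadius.div_const _).rpow_const fun _ ht =>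
    .inl (div_pos (h.meanRadius_pos ht) (h.meanRadius_pos ⟨le_rfl, hT⟩)).ne')

theorem hasDerivAt_energyBarrier (h : IsPCSF p T k ψ) {t D : ℝ} (ht : t ∈ Ioo 0 T)
    (hD : HasDerivAt (meanRadius k) D t) :
    HasDerivAt (energyBarrier κ q k) (q * D / meanRadius k t * energyBarrier κ q k t) t := by
  have h0 := h.meanRadius_pos ⟨le_rfl, ht.1.trans ht.2⟩
  have h1 := h.meanRadius_pos (Ioo_subset_Ico_self ht)
  have h2 := ((hD.div_const (meanRadius k 0)).rpow_const (p := q)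
    (.inl (div_pos h1 h0).ne')).const_mul (κ * (meanRadius k 0)⁻¹)
  refine h2.congr_deriv ?_
  rw [rpow_sub_one (div_pos h1 h0).ne', energyBarrier]
  field_simp

theorem highEnergy_le_weightedOscillation (h : IsPCSF p T k ψ) (hα : 0 ≤ α) (N : ℕ) {t : ℝ}
    (ht : t ∈ Ico 0 T) : highEnergy α N k t ≤ weightedOscillation α N k t := by
  have hk := h.continuous_space ht
  rw [weightedOscillation, tsum_eq_highMode_add
    (summable_fCoeff_sub_const hk _ (h.summable_truncWeight_mul hα N ht))]
  simp only [highMode_mul_fCoeff_sub_const hk _ (truncWeight α N t)]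
  have hn := fun n : ℤ => mul_nonneg (truncWeight_pos α N t n).le
    (norm_nonneg (fCoeff (fun θ => k θ t - (meanRadius k t)⁻¹) n))
  rw [highEnergy]
  linarith [hn 0, hn 1, hn (-1)]

theorem abs_sub_le_weightedOscillation (h : IsPCSF p T k ψ) (hα : 0 ≤ α) (N : ℕ) {t : ℝ}
    (ht : t ∈ Ico 0 T) (θ : ℝ) : |k θ t - (meanRadius k t)⁻¹| ≤ weightedOscillation α N k t := by
  have hk := h.continuous_space ht
  have hw := isFourierWeight_truncWeight (mul_nonneg hα ht.1) N
  exact (WienerBound.of_summable hw (f := fun θ => k θ t - (meanRadius k t)⁻¹) (by fun_prop)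
    (fun θ => by rw [h.2.1])
    (summable_fCoeff_sub_const hk _ (h.summable_truncWeight_mul hα N ht))).abs_le hw θ

theorem sum_high_derivative_le (h : IsPCSF p T k ψ) (hp : 1 ≤ p) (hα : 0 ≤ α) (N : ℕ) {t : ℝ}
    (ht : t ∈ Ioo 0 T) (hαt : α ≤ (meanRadius k t)⁻¹ ^ (p + 1) / 16)
    (hX : 32 * ((p + 6) * 2 ^ p) * weightedOscillation α N k t ≤ (meanRadius k t)⁻¹)
    (hXY : weightedOscillation α N k t ≤ 2 * highEnergy α N k t) :
    ∃ (Φ : ℝ → ℝ) (Φ' : ℝ), HasDerivAt Φ Φ' t ∧ Φ t = highEnergy α N k t ∧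
      (∀ s ∈ Ico 0 T, Φ s ≤ highEnergy α N k s) ∧
      Φ' ≤ -(1 / 2) * (meanRadius k t)⁻¹ ^ (p + 1) * highEnergy α N k t := by
  have ht' := Ioo_subset_Ico_self ht
  set c : ℝ → ℤ → ℂ := fun s n => fCoeff (fun θ => k θ s) n
  set σ : ℤ → ℂ := fun n => (starRingEnd ℂ) (c t n) / ‖c t n‖
  have hσ : ∀ n, ‖σ n‖ ≤ 1 := fun n => by
    simp only [σ, norm_div, RCLike.norm_conj, Complex.norm_real, norm_norm]
    exact div_self_le_one _
  have hσc : ∀ n, σ n * c t n = ‖c t n‖ := fun n => by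
    rcases eq_or_ne (c t n) 0 with h0 | h0
    · simp [h0]
    · have : (‖c t n‖ : ℂ) ≠ 0 := by exact_mod_cast norm_ne_zero_iff.2 h0
      simp only [σ]
      rw [div_mul_eq_mul_div, div_eq_iff this, Complex.conj_mul', sq]
  have hre : ∀ n, (σ n * c t n).re = ‖c t n‖ := fun n => by rw [hσc, Complex.ofReal_re]
  obtain ⟨hsum, hderiv⟩ := h.hasDerivAt_testedEnergy hα N ht hσ
  simp only [show ∀ n, (σ n * fCoeff (fun θ => k θ t) n).re = ‖fCoeff (fun θ => k θ t) n‖ from hre]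
    at hsum hderiv
  refine ⟨_, _, hderiv, tsum_congr fun n => by rw [hre n], fun s hs => ?_, ?_⟩
  · have hle : ∀ n, (σ n * c s n).re ≤ ‖c s n‖ := fun n =>
      (Complex.re_le_norm _).trans (by
        rw [norm_mul]; exact mul_le_of_le_one_left (norm_nonneg _) (hσ n))
    have hS := (h.summable_truncWeight_mul hα N hs).highMode_mul
    refine Summable.tsum_le_tsum (fun n => mul_le_mul_of_nonneg_left
      (mul_le_mul_of_nonneg_left (hle n) (truncWeight_pos α N s n).le) (highMode_nonneg n))
      (.of_norm_bounded (h.summable_truncWeight_mul hα N hs) fun n => ?_) hS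
    refine (abs_norm_highMode_le n _).trans ?_
    rw [abs_mul, abs_of_pos (truncWeight_pos α N s n)]
    refine mul_le_mul_of_nonneg_left ((Complex.abs_re_le_norm _).trans ?_)
      (truncWeight_pos α N s n).le
    rw [norm_mul]
    exact mul_le_of_le_one_left (norm_nonneg _) (hσ n)
  · have hfam := h.isSmoothFamily
    exact high_mode_dissipation (isFourierWeight_truncWeight (mul_nonneg hα ht.1.le) N) hp
      (fun θ => hfam.hasDerivAt_space θ ht') (fun θ => hfam.spaceDeriv.hasDerivAt_space θ ht')
      (hfam.spaceDeriv.spaceDeriv.continuous_space ht') (fun θ => hfam.periodic θ t ht')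
      (fun θ => hfam.spaceDeriv.periodic θ t ht')
      (fun θ => hfam.spaceDeriv.spaceDeriv.periodic θ t ht')
      (inv_pos.2 (h.meanRadius_pos ht')) (h.summable_truncWeight_mul hα N ht')
      (hfam.spaceDeriv.spaceDeriv.summable_truncWeight_mul hα N ht') hX hXY hα hαt
      (fun n => min_le_left _ _) hσ hσc hsum

/-- The energy of the frequencies other than `0, ±1` stays below the barrier. -/
theorem highEnergy_lt_energyBarrier (h : IsPCSF p T k ψ) (hp : 1 ≤ p) (hT : 0 < T) (hα : 0 ≤ α)
    (hαT : α * T ≤ log 2) (hα0 : α ≤ (meanRadius k 0)⁻¹ ^ (p + 1) / 16)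
    (hκ : 64 * ((p + 6) * 2 ^ p) * κ = 1) (hq : 4 * 2 ^ p * q = 1) (N : ℕ)
    (h0 : weightedOscillation α N k 0 < κ * (meanRadius k 0)⁻¹) :
    ∀ t ∈ Ico 0 T, highEnergy α N k t < energyBarrier κ q k t ∧
      weightedOscillation α N k t < 3 * κ * (meanRadius k t)⁻¹ := by
  have hpow : (1 : ℝ) ≤ 2 ^ p := one_le_pow₀ one_le_two
  have hC : (7 : ℝ) ≤ (p + 6) * 2 ^ p := by
    have : (1 : ℝ) ≤ p := by exact_mod_cast hp
    nlinarith
  have hκ0 : 0 < κ := by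
    by_contra! hneg
    nlinarith
  have hκ1 : 3 * κ ≤ 1 / 20 := by nlinarith
  have hq0 : 0 < q := by
    by_contra! hneg
    nlinarith
  have h0mem : (0 : ℝ) ∈ Ico 0 T := ⟨le_rfl, hT⟩
  have hL0 := h.meanRadius_pos h0mem
  suffices hpos : ∀ t ∈ Ico 0 T, 0 < min (energyBarrier κ q k t - highEnergy α N k t)
      (3 * κ * (meanRadius k t)⁻¹ - weightedOscillation α N k t) by
    intro t ht
    have := lt_min_iff.1 (hpos t ht)
    exact ⟨sub_pos.1 this.1, sub_pos.1 this.2⟩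
  refine pos_of_no_first_zero ?_ ?_ fun t ht hprev hzero => ?_
  · exact ((h.continuousOn_energyBarrier hT).sub (h.continuousOn_highEnergy hα N)).inf
      ((continuousOn_const.mul (h.continuousOn_meanRadius.inv₀ fun t ht =>
        (h.meanRadius_pos ht).ne')).sub (h.continuousOn_weightedOscillation hα N))
  · have hY := h.highEnergy_le_weightedOscillation hα N h0mem
    have hB : energyBarrier κ q k 0 = κ * (meanRadius k 0)⁻¹ := by
      rw [energyBarrier, div_self hL0.ne', one_rpow, mul_one]
    have : 0 < κ * (meanRadius k 0)⁻¹ := by positivity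
    refine lt_min ?_ ?_ <;> linarith
  have ht' := Ioo_subset_Ico_self ht
  have hL := h.meanRadius_pos ht'
  set L := meanRadius k t with hLdef
  set Y := highEnergy α N k t
  set X := weightedOscillation α N k t
  set B := energyBarrier κ q k t
  have hℓ : 0 < L⁻¹ := inv_pos.2 hL
  have hY : Y ≤ B := sub_nonneg.1 (hzero ▸ min_le_left _ _)
  have hX : X ≤ 3 * κ * L⁻¹ := sub_nonneg.1 (hzero ▸ min_le_right _ _)
  have hB : B ≤ κ * L⁻¹ := h.energyBarrier_le hp hκ0 hq0.le ht'
  have hB0 : 0 < B := h.energyBarrier_pos hκ0 ht'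
  have hk := h.continuous_space ht'
  have hαt : α * t ≤ log 2 := (mul_le_mul_of_nonneg_left ht.2.le hα).trans hαT
  have hαt0 : 0 ≤ α * t := mul_nonneg hα ht.1.le
  have hXY : X ≤ 2 * Y := tsum_le_two_mul_high (isFourierWeight_truncWeight hαt0 N)
    (truncWeight_le_two hαt0 hαt N (by norm_num)) (truncWeight_le_two hαt0 hαt N (by norm_num)) hk
    (fun θ => h.2.1 θ t) hℓ (h.summable_truncWeight_mul hα N ht') (by
      refine hX.trans ?_
      have := mul_le_mul_of_nonneg_right hκ1 hℓ.le
      linarith)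
    (fun n hn => by rw [h.fCoeff_inv ht' hn, one_div, inv_inv])
  have hX' : X < 3 * κ * L⁻¹ := by nlinarith [mul_pos hκ0 hℓ]
  have hYB : Y = B := by
    rcases min_choice (B - Y) (3 * κ * L⁻¹ - X) with hm | hm <;> rw [hm] at hzero <;> linarith
  have hX32 : 32 * ((p + 6) * 2 ^ p) * X ≤ L⁻¹ := by
    have h1 : X ≤ 2 * (κ * L⁻¹) := by linarith
    have h2 := mul_le_mul_of_nonneg_left h1 (show (0 : ℝ) ≤ 32 * ((p + 6) * 2 ^ p) by linarith)
    linear_combination h2 + L⁻¹ * hκ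
  have hαℓ : α ≤ L⁻¹ ^ (p + 1) / 16 := by
    refine hα0.trans (div_le_div_of_nonneg_right (pow_le_pow_left₀ (by positivity)
      ((inv_le_inv₀ hL0 hL).2 (h.meanRadius_le_initial hp ht')) _) (by norm_num))
  obtain ⟨Φ, Φ', hΦ, hΦt, hΦle, hΦ'⟩ := h.sum_high_derivative_le hp hα N ht hαℓ hX32 hXY
  obtain ⟨D, hD, -, hDM⟩ := h.exists_hasDerivAt_meanRadius hp ht
  have hkM : ∀ θ, k θ t ≤ 2 * L⁻¹ := fun θ => by
    have h1 := (abs_le.1 (h.abs_sub_le_weightedOscillation hα N ht' θ)).2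
    have h2 : X ≤ 1 / 20 * L⁻¹ := hX.trans (mul_le_mul_of_nonneg_right hκ1 hℓ.le)
    linarith
  have hDlow := hDM _ hkM
  have hG := deriv_nonpos_of_nonneg_left ht.1 ((h.hasDerivAt_energyBarrier ht hD).sub hΦ)
    (by simp only [Pi.sub_apply, hΦt]; exact sub_eq_zero.2 hYB.symm) fun s hs => by
      have hsT : s ∈ Ico 0 T := ⟨hs.1.le, hs.2.trans ht.2⟩
      have := (lt_min_iff.1 (hprev s ⟨hs.1.le, hs.2⟩)).1
      simp only [Pi.sub_apply]
      linarith [hΦle s hsT]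
  have hlow : -(1 / 4) * L⁻¹ ^ (p + 1) * B ≤ q * D / L * B := by
    refine mul_le_mul_of_nonneg_right ?_ hB0.le
    have h1 := mul_le_mul_of_nonneg_left hDlow (mul_pos hq0 hℓ).le
    have h2 : q * L⁻¹ * -(2 * L⁻¹) ^ p = -(1 / 4) * L⁻¹ ^ (p + 1) := by
      rw [mul_pow, pow_succ]
      linear_combination (-(1 / 4) * L⁻¹ ^ p * L⁻¹) * hq
    rw [h2] at h1
    refine h1.trans_eq ?_
    rw [div_eq_mul_inv]
    ring
  change Φ' ≤ -(1 / 2) * L⁻¹ ^ (p + 1) * Y at hΦ'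
  rw [hYB] at hΦ'
  have : 0 < L⁻¹ ^ (p + 1) * B := by positivity
  linarith

end IsPCSF

theorem norm_fCoeff_le_seminorm2 {f : ℝ → ℝ} {C : ℝ}
    (hC : ∀ n : ℤ, ‖fCoeff f n‖ ≤ C * (1 / (1 + (n : ℝ) ^ 2))) {n : ℤ} (hn : n ≠ 0) :
    ‖fCoeff f n‖ ≤ 4 * seminorm2 f * (1 / (1 + (n : ℝ) ^ 2)) := by
  have hbound : ∀ (m : ℤ) (x : ℝ), |x| ≤ ‖fCoeff f m‖ → (m : ℝ) ^ 2 * |x| ≤ C := fun m x hx => by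
    have h1 := hx.trans (hC m)
    rw [mul_one_div, le_div_iff₀ (by positivity)] at h1
    nlinarith [abs_nonneg x]
  have hre : (n : ℝ) ^ 2 * |(fCoeff f n).re| ≤ seminorm2 f :=
    (le_ciSup (f := fun m : ℤ => (m : ℝ) ^ 2 * |(fCoeff f m).re|)
      ⟨C, by rintro _ ⟨m, rfl⟩; exact hbound m _ (Complex.abs_re_le_norm _)⟩ n).trans
      (le_max_left _ _)
  have him : (n : ℝ) ^ 2 * |(fCoeff f n).im| ≤ seminorm2 f :=
    (le_ciSup (f := fun m : ℤ => (m : ℝ) ^ 2 * |(fCoeff f m).im|)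
      ⟨C, by rintro _ ⟨m, rfl⟩; exact hbound m _ (Complex.abs_im_le_norm _)⟩ n).trans
      (le_max_right _ _)
  have hn1 : (1 : ℝ) ≤ (n : ℝ) ^ 2 := by
    rw [one_le_sq_iff_one_le_abs]
    exact_mod_cast Int.one_le_abs hn
  have hnorm := Complex.norm_le_abs_re_add_abs_im (fCoeff f n)
  rw [mul_one_div, le_div_iff₀ (by positivity)]
  nlinarith [norm_nonneg (fCoeff f n)]

theorem fCoeff_zero (f : ℝ → ℝ) :
    fCoeff f 0 = ((1 / (2 * π) * ∫ θ in (0 : ℝ)..(2 * π), f θ : ℝ) : ℂ) := by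
  rw [fCoeff]
  simp only [Int.cast_zero, mul_zero, zero_mul, neg_zero, Complex.exp_zero, mul_one]
  rw [intervalIntegral.integral_ofReal]
  push_cast
  rfl

theorem fCoeff_zero_eq_re (f : ℝ → ℝ) : fCoeff f 0 = ((fCoeff f 0).re : ℂ) := by
  rw [fCoeff_zero, Complex.ofReal_re]

theorem abs_inv_mean_inv_sub_le {f : ℝ → ℝ} (hf : Continuous f) (hpos : ∀ θ, 0 < f θ) {m δ : ℝ}
    (hfm : ∀ θ, |f θ - m| ≤ δ) :
    |(1 / (2 * π) * ∫ θ in (0 : ℝ)..(2 * π), (f θ)⁻¹)⁻¹ - m| ≤ δ := by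
  have hcont : Continuous fun θ => (f θ)⁻¹ := hf.inv₀ fun θ => (hpos θ).ne'
  set L := 1 / (2 * π) * ∫ θ in (0 : ℝ)..(2 * π), (f θ)⁻¹ with hL
  have hL0 : 0 < L := mul_pos (by positivity) (intervalIntegral.intervalIntegral_pos_of_pos
    (hcont.intervalIntegrable _ _) (fun θ => inv_pos.2 (hpos θ)) two_pi_pos)
  have hone : 1 / (2 * π) * ∫ θ in (0 : ℝ)..(2 * π), (1 : ℝ) = 1 := by
    rw [intervalIntegral.integral_const, smul_eq_mul, sub_zero, mul_one]
    field_simp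
  have hmul : ∀ c : ℝ, c * L = 1 / (2 * π) * ∫ θ in (0 : ℝ)..(2 * π), c * (f θ)⁻¹ := fun c => by
    rw [intervalIntegral.integral_const_mul, hL]; ring
  have hlow : (m - δ) * L ≤ 1 := by
    rw [hmul]
    refine (mul_le_mul_of_nonneg_left (intervalIntegral.integral_mono_on two_pi_pos.le
      ((continuous_const.mul hcont).intervalIntegrable _ _)
      (continuous_const.intervalIntegrable _ _) fun θ _ => ?_) (by positivity)).trans_eq hone
    change (m - δ) * (f θ)⁻¹ ≤ 1
    rw [← div_eq_mul_inv, div_le_one (hpos θ)]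
    linarith [(abs_le.1 (hfm θ)).1]
  have hup : 1 ≤ (m + δ) * L := by
    rw [hmul]
    refine hone.symm.trans_le (mul_le_mul_of_nonneg_left (intervalIntegral.integral_mono_on
      two_pi_pos.le (continuous_const.intervalIntegrable _ _)
      ((continuous_const.mul hcont).intervalIntegrable _ _) fun θ _ => ?_) (by positivity))
    rw [← div_eq_mul_inv, one_le_div (hpos θ)]
    linarith [(abs_le.1 (hfm θ)).2]
  rw [abs_le]
  have h1 : m - δ ≤ L⁻¹ := by rwa [← one_div, le_div_iff₀ hL0]
  have h2 : L⁻¹ ≤ m + δ := by rwa [← one_div, div_le_iff₀ hL0]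
  constructor <;> linarith

theorem summable_norm_fCoeff_sub_mean {f : ℝ → ℝ} (hf : Continuous f) {A : ℝ}
    (hA : ∀ n : ℤ, n ≠ 0 → ‖fCoeff f n‖ ≤ A * (1 / (1 + (n : ℝ) ^ 2))) {ℓ δ : ℝ} (hA0 : 0 ≤ A)
    (hℓ : |(fCoeff f 0).re - ℓ| ≤ δ) :
    (Summable fun n => ‖fCoeff (fun θ => f θ - ℓ) n‖) ∧
    ∑' n, ‖fCoeff (fun θ => f θ - ℓ) n‖ ≤ A * (∑' n : ℤ, 1 / (1 + (n : ℝ) ^ 2)) + δ := by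
  have hle : ∀ n : ℤ, ‖fCoeff (fun θ => f θ - ℓ) n‖ ≤
      A * (1 / (1 + (n : ℝ) ^ 2)) + if n = 0 then δ else 0 := fun n => by
    rw [fCoeff_sub_const hf]
    split_ifs with h0
    · subst h0
      rw [fCoeff_zero_eq_re, ← Complex.ofReal_sub, Complex.norm_real, Real.norm_eq_abs]
      have : 0 ≤ A * (1 / (1 + ((0 : ℤ) : ℝ) ^ 2)) := by positivity
      linarith
    · rw [sub_zero, add_zero]
      exact hA n h0
  have hsum := (summable_one_div_one_add_sq.hasSum.mul_left A).add (hasSum_ite_eq (0 : ℤ) δ)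
  have hs : Summable fun n => ‖fCoeff (fun θ => f θ - ℓ) n‖ :=
    .of_nonneg_of_le (fun n => norm_nonneg _) hle hsum.summable
  exact ⟨hs, (hs.tsum_le_tsum hle hsum.summable).trans_eq hsum.tsum_eq⟩

namespace IsPCSF

variable {p : ℕ} {T : ℝ} {k : ℝ → ℝ → ℝ} {ψ : ℝ → ℝ} {α κ q : ℝ}

theorem weightedOscillation_initial_lt (h : IsPCSF p T k ψ) (hT : 0 < T) (hκ0 : 0 < κ)
    (hκ1 : κ ≤ 1)
    (hψ : 16 * (∑' n : ℤ, 1 / (1 + (n : ℝ) ^ 2)) / κ * seminorm2 ψ ≤ (fCoeff ψ 0).re) (N : ℕ) :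
    weightedOscillation α N k 0 < κ * (meanRadius k 0)⁻¹ := by
  have h0 : (0 : ℝ) ∈ Ico 0 T := ⟨le_rfl, hT⟩
  obtain rfl : (fun θ => k θ 0) = ψ := funext h.2.2.2.2.1
  set f : ℝ → ℝ := fun θ => k θ 0
  have hf : Continuous f := h.continuous_space h0
  obtain ⟨C, -, hC⟩ := h.isSmoothFamily.exists_norm_fCoeff_le hT
  have hdec : ∀ n : ℤ, n ≠ 0 → ‖fCoeff f n‖ ≤ 4 * seminorm2 f * (1 / (1 + (n : ℝ) ^ 2)) :=
    fun n hn => norm_fCoeff_le_seminorm2 (hC 0 ⟨le_rfl, le_rfl⟩) hn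
  have hs0 : 0 ≤ 4 * seminorm2 f := by
    have h1 := (norm_nonneg _).trans (hdec 1 one_ne_zero)
    norm_num at h1 ⊢
    linarith
  set S := ∑' n : ℤ, 1 / (1 + (n : ℝ) ^ 2)
  have hS : 0 < S := summable_one_div_one_add_sq.tsum_pos (fun n => by positivity) 0 (by norm_num)
  set m := (fCoeff f 0).re with hm
  set δ := 4 * seminorm2 f * S with hδ
  have hδ0 : 0 ≤ δ := mul_nonneg hs0 hS.le
  have hm0 : 0 < m := by
    rw [hm, fCoeff_zero, Complex.ofReal_re]
    exact mul_pos (by positivity) (intervalIntegral.intervalIntegral_pos_of_pos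
      (hf.intervalIntegrable _ _) (fun θ => h.pos θ h0) two_pi_pos)
  have hδm : 4 * δ ≤ κ * m := by
    rw [div_mul_eq_mul_div, div_le_iff₀ hκ0] at hψ
    rw [hδ]
    linarith
  obtain ⟨hsm, hle⟩ := summable_norm_fCoeff_sub_mean hf hdec (ℓ := m) (δ := 0) hs0 (by simp [m])
  have hw : IsFourierWeight (fun _ : ℤ => (1 : ℝ)) :=
    ⟨fun _ => le_rfl, rfl, fun _ _ => by norm_num⟩
  have hpt : ∀ θ, |f θ - m| ≤ δ := fun θ => by
    refine ((WienerBound.of_summable hw (f := fun θ => f θ - m) (by fun_prop)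
      (fun θ => by simp only [f, h.2.1]) (by simpa using hsm)).abs_le hw θ).trans ?_
    simpa only [one_mul, add_zero] using hle
  have hℓ : |(meanRadius k 0)⁻¹ - m| ≤ δ :=
    abs_inv_mean_inv_sub_le hf (fun θ => h.pos θ h0) hpt
  obtain ⟨-, hfin⟩ := summable_norm_fCoeff_sub_mean hf hdec (ℓ := (meanRadius k 0)⁻¹) (δ := δ) hs0
    (by rwa [abs_sub_comm])
  have hX : weightedOscillation α N k 0 ≤ 2 * δ := by
    simp only [weightedOscillation, truncWeight_at_zero, one_mul]
    linarith
  have := (abs_le.1 hℓ).1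
  nlinarith [mul_pos hκ0 hm0]

theorem tendsto_meanRadius (h : IsPCSF p T k ψ) (hT : 0 < T)
    (hk : ∀ t ∈ Ico 0 T, ∀ θ, k θ t ≤ 2 * (meanRadius k t)⁻¹) :
    Tendsto (meanRadius k) (nhdsWithin T (Iio T)) (nhds 0) := by
  have hsup := h.2.2.2.2.2.2.2.2.1
  refine tendsto_of_tendsto_of_tendsto_of_le_of_le' tendsto_const_nhds
    (tendsto_const_nhds.div_atTop hsup (a := (2 : ℝ))) ?_ ?_
  · filter_upwards [Ioo_mem_nhdsLT hT] with t ht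
    exact (h.meanRadius_pos (Ioo_subset_Ico_self ht)).le
  · filter_upwards [Ioo_mem_nhdsLT hT, hsup.eventually_gt_atTop 0] with t ht hpos
    have ht' := Ioo_subset_Ico_self ht
    have : Nonempty (Icc (0 : ℝ) (2 * π)) := ⟨⟨0, le_rfl, two_pi_pos.le⟩⟩
    have hle := ciSup_le fun θ : Icc (0 : ℝ) (2 * π) => hk t ht' θ
    rw [le_div_iff₀ hpos, mul_comm]
    exact (le_div_iff₀ (h.meanRadius_pos ht')).1 (hle.trans_eq (div_eq_mul_inv _ _).symm)

theorem meanRadius_pow_le (h : IsPCSF p T k ψ) (hp : 1 ≤ p) (hT : 0 < T)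
    (hk : ∀ t ∈ Ico 0 T, ∀ θ, k θ t ≤ 2 * (meanRadius k t)⁻¹) {t : ℝ} (ht : t ∈ Ico 0 T) :
    meanRadius k t ^ (p + 1) ≤ (p + 1) * 2 ^ p * (T - t) := by
  set C : ℝ := (p + 1) * 2 ^ p
  have hmono : MonotoneOn (fun t => meanRadius k t ^ (p + 1) + C * t) (Ico 0 T) := by
    have hder : ∀ s ∈ Ioo 0 T, ∃ D, HasDerivAt (fun t => meanRadius k t ^ (p + 1) + C * t) D s ∧
        0 ≤ D := fun s hs => by
      obtain ⟨D, hD, -, hDM⟩ := h.exists_hasDerivAt_meanRadius hp hs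
      have hL := h.meanRadius_pos (Ioo_subset_Ico_self hs)
      refine ⟨_, (hD.pow (p + 1)).add ((hasDerivAt_id s).const_mul C), ?_⟩
      have h1 := mul_le_mul_of_nonneg_left (hDM _ (hk s (Ioo_subset_Ico_self hs)))
        (show (0 : ℝ) ≤ (p + 1) * meanRadius k s ^ p by positivity)
      have h2 : (p + 1) * meanRadius k s ^ p * -(2 * (meanRadius k s)⁻¹) ^ p = -C := by
        rw [mul_pow, inv_pow]
        simp only [C]
        field_simp
      rw [h2] at h1
      push_cast
      simp only [mul_one]
      linarith
    refine monotoneOn_of_deriv_nonneg (convex_Ico 0 T)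
      ((h.continuousOn_meanRadius.pow _).add (by fun_prop)) ?_ ?_ <;>
      rw [interior_Ico] <;> intro s hs <;> obtain ⟨D, hD, hD0⟩ := hder s hs
    · exact hD.differentiableAt.differentiableWithinAt
    · rwa [hD.deriv]
  have hlim : Tendsto (fun t => meanRadius k t ^ (p + 1) + C * t) (nhdsWithin T (Iio T))
      (nhds (0 ^ (p + 1) + C * T)) :=
    ((h.tendsto_meanRadius hT hk).pow _).add
      (tendsto_nhdsWithin_of_tendsto_nhds ((continuous_const.mul continuous_id).tendsto T))
  have hle := ge_of_tendsto hlim (b := meanRadius k t ^ (p + 1) + C * t) (by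
    filter_upwards [Ioo_mem_nhdsLT ht.2] with s hs
    exact hmono ht ⟨ht.1.trans hs.1.le, hs.2⟩ hs.1.le)
  rw [zero_pow (Nat.succ_ne_zero p), zero_add] at hle
  linarith

theorem norm_fCoeff_le_highEnergy (h : IsPCSF p T k ψ) (hα : 0 ≤ α) {t : ℝ} (ht : t ∈ Ico 0 T)
    {n : ℤ} (hn : 2 ≤ |n|) :
    exp (α * t * |(n : ℝ)|) * ‖fCoeff (fun θ => k θ t) n‖ ≤ highEnergy α n.natAbs k t := by
  have hle := (h.summable_truncWeight_mul hα n.natAbs ht).highMode_mul.le_tsum n fun m _ =>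
    mul_nonneg (highMode_nonneg m) (mul_nonneg (truncWeight_pos α n.natAbs t m).le (norm_nonneg _))
  rw [highMode_of_two_le hn, one_mul, truncWeight,
    show ((n.natAbs : ℕ) : ℝ) = |(n : ℝ)| by rw [Nat.cast_natAbs, Int.cast_abs], min_self] at hle
  exact hle

end IsPCSF

/-- There are `c_p > 0` and `ε₀ > 0` depending only on `p`, and (given the
smallness condition) `μ > 0` depending on `p` and `ψ`, such that for every `ε ∈ (0,ε₀)` there
is `b > 0` with `|k̂(n,t)| ≤ b e^{-μ|n|}(T-t)^ε` for all `n ≠ 0, ±1` and all `t ∈ (T/2,T)`. -/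
theorem statement8 (p : ℕ) (hp : 1 ≤ p) :
    ∃ cp > (0:ℝ), ∃ ε₀ > (0:ℝ), ∀ (T : ℝ), 0 < T → ∀ (k : ℝ → ℝ → ℝ) (ψ : ℝ → ℝ),
      IsPCSF p T k ψ →
      cp * seminorm2 ψ ≤ (fCoeff ψ 0).re →
      ∃ μ > (0:ℝ), ∀ ε : ℝ, 0 < ε → ε < ε₀ →
        ∃ b > (0:ℝ), ∀ n : ℤ, n ≠ 0 → n ≠ 1 → n ≠ -1 →
          ∀ t : ℝ, T / 2 < t → t < T →
            ‖fCoeff (fun θ => k θ t) n‖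
              ≤ b * Real.exp (-μ * |(n : ℝ)|) * (T - t) ^ ε := by
  set Q : ℝ := (p + 6) * 2 ^ p
  have hQ : (7 : ℝ) ≤ Q := by
    have h1 : (1 : ℝ) ≤ p := by exact_mod_cast hp
    have h2 : (1 : ℝ) ≤ 2 ^ p := one_le_pow₀ one_le_two
    simp only [Q]
    nlinarith
  set κ : ℝ := (64 * Q)⁻¹
  have hκ : 64 * Q * κ = 1 := mul_inv_cancel₀ (by positivity)
  have hκ0 : 0 < κ := by positivity
  have hκ1 : κ ≤ 1 := inv_le_one_of_one_le₀ (by linarith)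
  have hκ3 : 3 * κ ≤ 1 := by nlinarith
  set q : ℝ := (4 * 2 ^ p)⁻¹
  have hq : 4 * 2 ^ p * q = 1 := mul_inv_cancel₀ (by positivity)
  have hq0 : 0 < q := by positivity
  set S : ℝ := ∑' n : ℤ, 1 / (1 + (n : ℝ) ^ 2)
  have hS : 0 < S := summable_one_div_one_add_sq.tsum_pos (fun n => by positivity) 0 (by norm_num)
  refine ⟨16 * S / κ, by positivity, q / (p + 1), by positivity, fun T hT k ψ h hψ => ?_⟩
  have h0 : (0 : ℝ) ∈ Ico 0 T := ⟨le_rfl, hT⟩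
  have hL0 := h.meanRadius_pos h0
  set α : ℝ := min (Real.log 2 / T) ((meanRadius k 0)⁻¹ ^ (p + 1) / 16)
  have hα : 0 < α := lt_min (div_pos (Real.log_pos one_lt_two) hT) (by positivity)
  have hαT : α * T ≤ Real.log 2 := (le_div_iff₀ hT).1 (min_le_left _ _)
  have hmain := fun N => h.highEnergy_lt_energyBarrier hp hT hα.le hαT (min_le_right _ _) hκ hq N
    (h.weightedOscillation_initial_lt hT hκ0 hκ1 hψ N)
  have hk : ∀ t ∈ Ico 0 T, ∀ θ, k θ t ≤ 2 * (meanRadius k t)⁻¹ := fun t ht θ => by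
    have h1 := (abs_le.1 (h.abs_sub_le_weightedOscillation hα.le 0 ht θ)).2
    have h2 := mul_le_mul_of_nonneg_right hκ3 (inv_pos.2 (h.meanRadius_pos ht)).le
    linarith [(hmain 0 t ht).2]
  set ε₀ : ℝ := q / (p + 1)
  set C : ℝ := (p + 1) * 2 ^ p
  set K : ℝ := κ * (meanRadius k 0)⁻¹ * (C ^ ε₀ / meanRadius k 0 ^ q)
  have hK : 0 < K := by positivity
  have hbarrier : ∀ t ∈ Ico 0 T, energyBarrier κ q k t ≤ K * (T - t) ^ ε₀ := fun t ht => by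
    have hL := h.meanRadius_pos ht
    have hpow : meanRadius k t ^ q = (meanRadius k t ^ (p + 1)) ^ ε₀ := by
      rw [← Real.rpow_natCast, ← Real.rpow_mul hL.le]
      congr 1
      simp only [ε₀]
      push_cast
      field_simp
    have hle : meanRadius k t ^ q ≤ C ^ ε₀ * (T - t) ^ ε₀ := by
      rw [hpow, ← Real.mul_rpow (by positivity) (sub_nonneg.2 ht.2.le)]
      exact Real.rpow_le_rpow (by positivity) (h.meanRadius_pow_le hp hT hk ht) (by positivity)
    rw [energyBarrier, Real.div_rpow hL.le hL0.le]
    simp only [K]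
    rw [mul_assoc _ (C ^ ε₀ / _), div_mul_eq_mul_div]
    exact mul_le_mul_of_nonneg_left (div_le_div_of_nonneg_right hle (by positivity)) (by positivity)
  refine ⟨α * (T / 2), by positivity, fun ε _ hε => ⟨K * T ^ (ε₀ - ε), by positivity,
    fun n hn0 hn1 hn2 t ht htT => ?_⟩⟩
  have ht0 : 0 < t := by linarith
  have htmem : t ∈ Ico 0 T := ⟨ht0.le, htT⟩
  have hn : 2 ≤ |n| := by rw [le_abs]; omega
  have hE := (h.norm_fCoeff_le_highEnergy hα.le htmem hn).trans
    ((hmain n.natAbs t htmem).1.le.trans (hbarrier t htmem))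
  have hTt : 0 < T - t := sub_pos.2 htT
  have hsplit : (T - t) ^ ε₀ ≤ T ^ (ε₀ - ε) * (T - t) ^ ε := by
    have h1 : (T - t) ^ ε₀ = (T - t) ^ (ε₀ - ε) * (T - t) ^ ε := by
      rw [← Real.rpow_add hTt, sub_add_cancel]
    rw [h1]
    exact mul_le_mul_of_nonneg_right (Real.rpow_le_rpow hTt.le (by linarith) (by linarith))
      (by positivity)
  have hexp : Real.exp (-(α * t * |(n : ℝ)|)) ≤ Real.exp (-(α * (T / 2)) * |(n : ℝ)|) := by
    rw [Real.exp_le_exp, neg_mul, neg_le_neg_iff]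
    exact mul_le_mul_of_nonneg_right (mul_le_mul_of_nonneg_left ht.le hα.le) (abs_nonneg _)
  calc ‖fCoeff (fun θ => k θ t) n‖
      = Real.exp (-(α * t * |(n : ℝ)|)) *
          (Real.exp (α * t * |(n : ℝ)|) * ‖fCoeff (fun θ => k θ t) n‖) := by
        rw [← mul_assoc, ← Real.exp_add, neg_add_cancel, Real.exp_zero, one_mul]
    _ ≤ Real.exp (-(α * (T / 2)) * |(n : ℝ)|) * (K * (T ^ (ε₀ - ε) * (T - t) ^ ε)) :=
        mul_le_mul hexp (hE.trans (mul_le_mul_of_nonneg_left hsplit hK.le)) (by positivity)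
          (Real.exp_pos _).le
    _ = K * T ^ (ε₀ - ε) * Real.exp (-(α * (T / 2)) * |(n : ℝ)|) * (T - t) ^ ε := by ring
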